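/- Suppose g ∈ H^t with t ≥ 1, the continuous function on 𝕌 with Fourier coefficients g is nonvanishing (min_{z∈𝕌}|g(z)| > 0), and the equation 𝒞⁺u − (𝒞⁻u)·g = g − 1 has a unique solution u ∈ L², which moreover lies in H^t. Let s be a real number with either s = 0 or s > 1/2, and assume 2s < t. Then there exist N₀ > 0 and C_{s,t} > 0 such that for every N > N₀ the operator id − 𝓘_N𝓜(g−1)𝒞⁻ : ran 𝒫_N → ran 𝒫_N is invertible, and the unique u_N ∈ ran 𝒫_N satisfying (id − 𝓘_N𝓜(g−1)𝒞⁻)u_N = 𝓘_N(g − 1) obeys ‖u − u_N‖_s ≤ C_{s,t}·N^{s−t}. -/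

import Mathlib

noncomputable section

open scoped BigOperators

/-- The Sobolev weight `max(1,|j|)`. -/
def wt (j : ℤ) : ℝ := max 1 |(j : ℝ)|

/-- Membership of a two-sided sequence in the Sobolev space `H^s`. -/
def hsumm (s : ℝ) (u : ℤ → ℂ) : Prop :=
  Summable fun j : ℤ => ‖u j‖ ^ 2 * wt j ^ (2 * s)

/-- The `H^s` norm of a two-sided sequence. -/
def hnorm (s : ℝ) (u : ℤ → ℂ) : ℝ :=
  Real.sqrt (∑' j : ℤ, ‖u j‖ ^ 2 * wt j ^ (2 * s))

/-- `N₋ = ⌊N/2⌋`. -/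
def Nmin (N : ℕ) : ℤ := (N : ℤ) / 2

/-- `N₊ = ⌊(N-1)/2⌋`. -/
def Npl (N : ℕ) : ℤ := ((N : ℤ) - 1) / 2

/-- The Fourier truncation projection `𝒫_N`. -/
def projP (N : ℕ) (u : ℤ → ℂ) : ℤ → ℂ :=
  fun j => if -Nmin N ≤ j ∧ j ≤ Npl N then u j else 0

/-- The trigonometric interpolation projection `𝓘_N` (via the aliasing formula). -/
def interpI (N : ℕ) (u : ℤ → ℂ) : ℤ → ℂ :=
  fun j => if -Nmin N ≤ j ∧ j ≤ Npl N then ∑' p : ℤ, u (p * (N : ℤ) + j) else 0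

/-- Membership in `ran 𝒫_N`. -/
def inPN (N : ℕ) (u : ℤ → ℂ) : Prop := projP N u = u

/-- The boundary value `𝒞⁺` of the Cauchy transform: keep the nonnegative modes. -/
def Cpl (u : ℤ → ℂ) : ℤ → ℂ := fun j => if 0 ≤ j then u j else 0

/-- The boundary value `𝒞⁻` of the Cauchy transform: `-1` times the negative modes. -/
def Cmn (u : ℤ → ℂ) : ℤ → ℂ := fun j => if j < 0 then -u j else 0

/-- Multiplication of functions on `𝕌`, i.e. convolution of Fourier coefficients:
`𝓜(g)u = g·u`. -/
def cmul (g u : ℤ → ℂ) : ℤ → ℂ := fun n => ∑' j : ℤ, g (n - j) * u j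

/-- The Fourier coefficients of the constant function `1`. -/
def one1 : ℤ → ℂ := fun j => if j = 0 then 1 else 0
/-- The continuous function on `𝕌` with Fourier coefficients `g` is nonvanishing:
`min_{z ∈ 𝕌} |g(z)| > 0`. -/
def nonvanishing (g : ℤ → ℂ) : Prop :=
  ∃ ε : ℝ, 0 < ε ∧ ∀ θ : ℝ,
    ε ≤ ‖∑' j : ℤ, g j * Complex.exp (Complex.I * (j : ℂ) * (θ : ℂ))‖

/-- The Toeplitz operator `𝒯(g) = 𝒞⁺ 𝓜(g) 𝒞⁺`. -/
def Topl (g u : ℤ → ℂ) : ℤ → ℂ := Cpl (cmul g (Cpl u))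

/-- The Hilbert space of square-summable two-sided sequences. -/
abbrev L2Z := lp (fun _ : ℤ => ℂ) 2

namespace L2Z

theorem memℓp_two_iff {f : ℤ → ℂ} : Memℓp f 2 ↔ Summable fun n => ‖f n‖ ^ 2 := by
  rw [memℓp_gen_iff (by norm_num)]
  simp

theorem summable_sq (v : L2Z) : Summable fun n => ‖v n‖ ^ 2 :=
  memℓp_two_iff.1 (lp.memℓp v)

theorem norm_sq_eq (v : L2Z) : ‖v‖ ^ 2 = ∑' n, ‖v n‖ ^ 2 := by
  have := lp.norm_rpow_eq_tsum (p := 2) (by norm_num) v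
  simpa using this

/-- A square-summable sequence as an element of `L2Z`. -/
def mk (f : ℤ → ℂ) (hf : Summable fun n => ‖f n‖ ^ 2) : L2Z := ⟨f, memℓp_two_iff.2 hf⟩

@[simp] theorem mk_apply (f : ℤ → ℂ) (hf) (n : ℤ) : mk f hf n = f n := rfl

theorem norm_le_of_tsum_le {v : L2Z} {C : ℝ} (hC : 0 ≤ C) (h : ∑' n, ‖v n‖ ^ 2 ≤ C ^ 2) :
    ‖v‖ ≤ C := by
  rw [← norm_sq_eq] at h
  exact le_of_sq_le_sq h hC

theorem norm_apply_le (v : L2Z) (n : ℤ) : ‖v n‖ ≤ ‖v‖ :=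
  lp.norm_apply_le_norm (by norm_num) v n

/-- Evaluation at an index. -/
def eval (n : ℤ) : L2Z →L[ℂ] ℂ :=
  LinearMap.mkContinuous
    { toFun := fun v => v n, map_add' := fun _ _ => rfl, map_smul' := fun _ _ => rfl } 1
    fun v => (norm_apply_le v n).trans (one_mul ‖v‖).ge

@[simp] theorem eval_apply (n : ℤ) (v : L2Z) : eval n v = v n := rfl

theorem tsum_apply {ι : Type*} {f : ι → L2Z} (hf : Summable f) (n : ℤ) :
    (∑' i, f i) n = ∑' i, f i n := (eval n).map_tsum hf

theorem summable_weighted_shift (c : ℤ → ℂ) (hc : ∀ n, ‖c n‖ ≤ 1) (k : ℤ) (v : L2Z) :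
    Summable fun n => ‖c n * v (n - k)‖ ^ 2 := by
  refine Summable.of_nonneg_of_le (fun _ => by positivity) (fun n => ?_)
    ((Equiv.subRight k).summable_iff.2 (summable_sq v))
  simp only [Function.comp, Equiv.subRight_apply]
  rw [norm_mul]
  gcongr
  exact mul_le_of_le_one_left (norm_nonneg _) (hc n)

/-- The weighted shift `v ↦ (n ↦ c n * v (n - k))`. -/
def weightedShift (c : ℤ → ℂ) (hc : ∀ n, ‖c n‖ ≤ 1) (k : ℤ) : L2Z →L[ℂ] L2Z :=
  LinearMap.mkContinuous
    { toFun := fun v => mk (fun n => c n * v (n - k)) (summable_weighted_shift c hc k v)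
      map_add' := fun v w => by ext n; simp [mul_add]
      map_smul' := fun a v => by ext n; simp; ring } 1
    fun v => by
      rw [one_mul]
      refine norm_le_of_tsum_le (norm_nonneg _) ?_
      rw [norm_sq_eq, ← (Equiv.subRight k).tsum_eq fun n => ‖v n‖ ^ 2]
      refine (summable_weighted_shift c hc k v).tsum_le_tsum (fun n => ?_)
        ((Equiv.subRight k).summable_iff.2 (summable_sq v))
      change ‖c n * v (n - k)‖ ^ 2 ≤ ‖v (n - k)‖ ^ 2
      rw [norm_mul]
      gcongr
      exact mul_le_of_le_one_left (norm_nonneg _) (hc n)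

@[simp] theorem weightedShift_apply (c hc k) (v : L2Z) (n : ℤ) :
    weightedShift c hc k v n = c n * v (n - k) := rfl

theorem norm_weightedShift_le (c hc k) : ‖weightedShift c hc k‖ ≤ 1 :=
  LinearMap.mkContinuous_norm_le _ zero_le_one _

theorem isCompactOperator_weightedShift (c : ℤ → ℂ) (hc : ∀ n, ‖c n‖ ≤ 1) (k : ℤ)
    (hfin : {n | c n ≠ 0}.Finite) : IsCompactOperator (weightedShift c hc k) := by
  classical
  have h : weightedShift c hc k = ∑ n ∈ hfin.toFinset,
      (c n) • ((lp.singleContinuousLinearMap ℂ (fun _ : ℤ => ℂ) 2 n).comp (eval (n - k))) := by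
    ext v m
    rw [weightedShift_apply, sum_apply, lp.coeFn_sum, Finset.sum_apply]
    by_cases hm : c m = 0
    · rw [hm, zero_mul, Finset.sum_eq_zero]
      intro n hn
      have : m ≠ n := by rintro rfl; simp [hm] at hn
      simp [lp.single_apply, this]
    · rw [Finset.sum_eq_single m]
      · simp
      · intro n _ hn
        simp [lp.single_apply, hn.symm]
      · intro h; simp [hm] at h
  rw [h]
  have key : ∀ s : Finset ℤ, (∑ n ∈ s,
      (c n) • ((lp.singleContinuousLinearMap ℂ (fun _ : ℤ => ℂ) 2 n).comp (eval (n - k)))) ∈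
      compactOperator (RingHom.id ℂ) L2Z L2Z := by
    intro s
    refine Submodule.sum_mem _ fun n _ => Submodule.smul_mem _ _ ?_
    have h1 : IsCompactOperator (eval (n - k)) := isCompactOperator_of_locallyCompactSpace_dom _
    exact h1.clm_comp (lp.singleContinuousLinearMap ℂ (fun _ : ℤ => ℂ) 2 n)
  exact key _

/-- The coordinate projection onto a set of indices. -/
def proj (S : Set ℤ) : L2Z →L[ℂ] L2Z :=
  weightedShift (S.indicator 1) (fun n => by
    classical
    rw [Set.indicator_apply]; split_ifs <;> simp) 0

theorem proj_apply (S : Set ℤ) (v : L2Z) (n : ℤ) : proj S v n = S.indicator v n := by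
  classical
  simp [proj, Set.indicator_apply]

theorem norm_proj_apply_le (S : Set ℤ) (v : L2Z) : ‖proj S v‖ ≤ ‖v‖ :=
  ((proj S).le_opNorm v).trans
    (mul_le_of_le_one_left (norm_nonneg _) (norm_weightedShift_le _ _ _))

theorem proj_add_proj_compl (S : Set ℤ) (v : L2Z) : proj S v + proj Sᶜ v = v := by
  classical
  ext n
  by_cases h : n ∈ S <;> simp [proj_apply, h]

/-- The series of weighted shifts with summable coefficients. -/
def shiftSeries (g : ℤ → ℂ) (c : ℤ → ℤ → ℂ) (hc : ∀ k n, ‖c k n‖ ≤ 1) : L2Z →L[ℂ] L2Z :=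
  ∑' k, g k • weightedShift (c k) (hc k) k

section shiftSeries

variable {g : ℤ → ℂ} (hg : Summable fun k => ‖g k‖) (c : ℤ → ℤ → ℂ) (hc : ∀ k n, ‖c k n‖ ≤ 1)
include hg

theorem summable_shiftSeries : Summable fun k => g k • weightedShift (c k) (hc k) k := by
  refine Summable.of_norm_bounded hg fun k => ?_
  rw [norm_smul]
  exact mul_le_of_le_one_right (norm_nonneg _) (norm_weightedShift_le _ _ _)

theorem shiftSeries_apply (v : L2Z) (n : ℤ) :
    shiftSeries g c hc v n = ∑' k, g k * (c k n * v (n - k)) := by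
  have h := summable_shiftSeries hg c hc
  have h1 := h.hasSum.mapL (ContinuousLinearMap.apply ℂ L2Z v)
  have h2 := h1.mapL (eval n)
  exact h2.tsum_eq.symm

theorem isCompactOperator_shiftSeries (hfin : ∀ k, {n | c k n ≠ 0}.Finite) :
    IsCompactOperator (shiftSeries g c hc) := by
  have h := (summable_shiftSeries hg c hc).hasSum
  refine isCompactOperator_of_tendsto h (.of_forall fun s => ?_)
  have key : (∑ k ∈ s, g k • weightedShift (c k) (hc k) k) ∈
      compactOperator (RingHom.id ℂ) L2Z L2Z :=
    Submodule.sum_mem _ fun k _ => Submodule.smul_mem _ _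
      (isCompactOperator_weightedShift _ _ _ (hfin k))
  exact key

end shiftSeries

/-- Multiplication by the function with Fourier coefficients `g`. -/
def conv (g : ℤ → ℂ) : L2Z →L[ℂ] L2Z := shiftSeries g (fun _ _ => 1) (by simp)

theorem conv_apply {g : ℤ → ℂ} (hg : Summable fun k => ‖g k‖) (v : L2Z) (n : ℤ) :
    conv g v n = ∑' k, g k * v (n - k) := by
  simp [conv, shiftSeries_apply hg]

/-- The singular integral operator `proj Sᶜ + conv g ∘ proj S`. -/
def sio (g : ℤ → ℂ) (S : Set ℤ) : L2Z →L[ℂ] L2Z := proj Sᶜ + (conv g).comp (proj S)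

/-- The off-diagonal block `proj Sᶜ ∘ conv g ∘ proj S` is compact. -/
theorem isCompactOperator_offDiag {g : ℤ → ℂ} (hg : Summable fun k => ‖g k‖) (S : Set ℤ)
    (hS : ∀ k : ℤ, {n | n ∉ S ∧ n - k ∈ S}.Finite) :
    IsCompactOperator ((proj Sᶜ).comp ((conv g).comp (proj S))) := by
  classical
  have h := isCompactOperator_shiftSeries hg
    (fun k n => if n ∉ S ∧ n - k ∈ S then 1 else 0)
    (fun k n => by split_ifs <;> simp) (fun k => by simpa using hS k)
  convert h using 2
  ext v n
  rw [shiftSeries_apply hg]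
  by_cases hn : n ∈ S
  · simp [proj_apply, hn]
  · simp [proj_apply, hn, conv_apply hg, Set.indicator_apply]

/-- An injective operator satisfying an a priori estimate modulo a compact operator is bounded
below. -/
theorem exists_norm_le_of_compact {A K : L2Z →L[ℂ] L2Z} (hK : IsCompactOperator K) {C : ℝ}
    (hAK : ∀ v, ‖v‖ ≤ C * (‖A v‖ + ‖K v‖)) (hA : ∀ v, A v = 0 → v = 0) :
    ∃ c, 0 < c ∧ ∀ v, ‖v‖ ≤ c * ‖A v‖ := by
  by_contra! hcon
  have h1 : ∀ n : ℕ, ∃ v : L2Z, ‖v‖ = 1 ∧ ‖A v‖ < 1 / ((n : ℝ) + 1) := by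
    intro n
    obtain ⟨v, hv⟩ := hcon (n + 1) (by positivity)
    have hv0 : 0 < ‖v‖ := lt_of_le_of_lt (by positivity) hv
    refine ⟨((‖v‖⁻¹ : ℝ) : ℂ) • v, ?_, ?_⟩
    · rw [norm_smul]; simp [hv0.ne']
    · rw [map_smul, norm_smul, lt_div_iff₀ (by positivity)]
      simp only [Complex.norm_real, norm_inv, norm_norm]
      rw [mul_assoc, inv_mul_lt_iff₀ hv0]
      linarith
  choose v hv1 hvA using h1
  obtain ⟨Q, hQ, hQs⟩ := hK.image_closedBall_subset_compact (f := (K : L2Z →ₗ[ℂ] L2Z)) 1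
  obtain ⟨a, -, φ, hφ, ha⟩ := hQ.tendsto_subseq (x := fun n => K (v n))
    fun n => hQs ⟨v n, by simp [hv1], rfl⟩
  have hA0 : Filter.Tendsto (fun n => A (v n)) Filter.atTop (nhds 0) :=
    squeeze_zero_norm (fun n => (hvA n).le) tendsto_one_div_add_atTop_nhds_zero_nat
  have hA0' := hA0.comp hφ.tendsto_atTop
  have hc : CauchySeq (v ∘ φ) := by
    have h2 := ha.cauchySeq
    have h3 := hA0'.cauchySeq
    rw [Metric.cauchySeq_iff] at h2 h3 ⊢
    intro ε hε
    have hC : 0 < |C| + 1 := by positivity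
    obtain ⟨N2, hN2⟩ := h2 (ε / (2 * (|C| + 1))) (by positivity)
    obtain ⟨N3, hN3⟩ := h3 (ε / (2 * (|C| + 1))) (by positivity)
    refine ⟨max N2 N3, fun m hm n hn => ?_⟩
    have h4 := hN2 m (le_of_max_le_left hm) n (le_of_max_le_left hn)
    have h5 := hN3 m (le_of_max_le_right hm) n (le_of_max_le_right hn)
    simp only [Function.comp, dist_eq_norm, ← map_sub] at h4 h5 ⊢
    refine (hAK _).trans_lt ?_
    calc C * (‖A (v (φ m) - v (φ n))‖ + ‖K (v (φ m) - v (φ n))‖)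
        ≤ (|C| + 1) * (‖A (v (φ m) - v (φ n))‖ + ‖K (v (φ m) - v (φ n))‖) := by
          gcongr; linarith [le_abs_self C]
      _ < (|C| + 1) * (ε / (2 * (|C| + 1)) + ε / (2 * (|C| + 1))) := by gcongr
      _ = ε := by field_simp; ring
  obtain ⟨w, hw⟩ := cauchySeq_tendsto_of_complete hc
  have hw1 : ‖w‖ = 1 := by
    have := hw.norm
    simp only [Function.comp, hv1] at this
    exact (tendsto_nhds_unique this tendsto_const_nhds)
  have hAw : A w = 0 := tendsto_nhds_unique ((A.continuous.tendsto w).comp hw) hA0'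
  rw [hA w hAw] at hw1
  simp at hw1

/-- An injective singular integral operator with elliptic symbol is bounded below. -/
theorem exists_norm_le_sio {g : ℤ → ℂ} (hg : Summable fun k => ‖g k‖) {ε : ℝ} (hε : 0 < ε)
    (hlow : ∀ v, ε * ‖v‖ ≤ ‖conv g v‖) (S : Set ℤ)
    (hS : ∀ k : ℤ, {n | n ∉ S ∧ n - k ∈ S}.Finite) (hinj : ∀ v, sio g S v = 0 → v = 0) :
    ∃ c, 0 < c ∧ ∀ v, ‖v‖ ≤ c * ‖sio g S v‖ := by
  refine exists_norm_le_of_compact (isCompactOperator_offDiag hg S hS) (C := 1 + ε⁻¹)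
    (fun v => ?_) hinj
  set K := (proj Sᶜ).comp ((conv g).comp (proj S)) with hK
  have h1 : conv g (proj S v) = proj S (sio g S v) + K v := by
    ext n
    by_cases hn : n ∈ S <;> simp [sio, hK, proj_apply, hn]
  have h2 : proj Sᶜ v = proj Sᶜ (sio g S v) - K v := by
    ext n
    by_cases hn : n ∈ S <;> simp [sio, hK, proj_apply, hn]
  have h3 : ‖proj S v‖ ≤ ε⁻¹ * (‖sio g S v‖ + ‖K v‖) := by
    rw [le_inv_mul_iff₀ hε]
    refine (hlow _).trans ?_
    rw [h1]
    exact (norm_add_le _ _).trans (by gcongr; exact norm_proj_apply_le _ _)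
  have h4 : ‖proj Sᶜ v‖ ≤ ‖sio g S v‖ + ‖K v‖ := by
    rw [h2]
    exact (norm_sub_le _ _).trans (by gcongr; exact norm_proj_apply_le _ _)
  calc ‖v‖ = ‖proj S v + proj Sᶜ v‖ := by rw [proj_add_proj_compl]
    _ ≤ ‖proj S v‖ + ‖proj Sᶜ v‖ := norm_add_le _ _
    _ ≤ _ := by linarith

open MeasureTheory

theorem continuous_tsum_fourier {g : ℤ → ℂ} (hg : Summable fun k => ‖g k‖) :
    Continuous fun x : UnitAddCircle => ∑' k, g k * fourier k x :=
  continuous_tsum (fun k => by fun_prop) hg fun k x => by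
    rw [norm_mul, fourier_apply, Circle.norm_coe, mul_one]

theorem norm_mul_fourier (a : ℂ) (k : ℤ) (x : UnitAddCircle) : ‖a * fourier k x‖ = ‖a‖ := by
  rw [norm_mul, fourier_apply, Circle.norm_coe, mul_one]

theorem norm_tsum_fourier_le {g : ℤ → ℂ} (hg : Summable fun k => ‖g k‖) (x : UnitAddCircle) :
    ‖∑' k, g k * fourier k x‖ ≤ ∑' k, ‖g k‖ := by
  simpa only [norm_mul_fourier] using
    norm_tsum_le_tsum_norm (f := fun k => g k * fourier k x) (by simpa only [norm_mul_fourier])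

theorem fourierCoeff_tsum_fourier_mul {g : ℤ → ℂ} (hg : Summable fun k => ‖g k‖)
    {V : UnitAddCircle → ℂ} (hV : Integrable V AddCircle.haarAddCircle) (n : ℤ) :
    fourierCoeff (fun x => (∑' k, g k * fourier k x) * V x) n =
      ∑' k, g k * fourierCoeff V (n - k) := by
  have hF : ∀ (k : ℤ) (x : UnitAddCircle),
      ‖g k * (fourier (-(n - k)) x * V x)‖ = ‖g k‖ * ‖V x‖ := fun k x => by
    rw [← mul_assoc, norm_mul, norm_mul_fourier]
  have h := hasSum_integral_of_summable_integral_norm (μ := AddCircle.haarAddCircle)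
    (F := fun (k : ℤ) (x : UnitAddCircle) => g k * (fourier (-(n - k)) x * V x))
    (fun k => (hV.fourier_smul (-(n - k))).const_mul (g k)) (by
      simp only [hF, integral_const_mul]
      exact hg.mul_right _)
  simp only [integral_const_mul] at h
  simp only [fourierCoeff, smul_eq_mul]
  rw [h.tsum_eq]
  congr 1
  ext x
  rw [← mul_assoc, ← tsum_mul_left, ← tsum_mul_right]
  congr 1
  ext k
  rw [show -(n - k) = -n + k by ring, fourier_add]
  ring

/-- Multiplication by a nonvanishing function is bounded below. -/
theorem exists_norm_le_conv {g : ℤ → ℂ} (hg : Summable fun k => ‖g k‖) (hnv : nonvanishing g) :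
    ∃ ε, 0 < ε ∧ ∀ v, ε * ‖v‖ ≤ ‖conv g v‖ := by
  obtain ⟨ε, hε, hlow⟩ := hnv
  refine ⟨ε, hε, fun v => ?_⟩
  have hlow' : ∀ x : UnitAddCircle, ε ≤ ‖∑' k, g k * fourier k x‖ := by
    intro x
    induction x using QuotientAddGroup.induction_on with
    | H r =>
      convert hlow (2 * Real.pi * r) using 5 with k
      rw [fourier_coe_apply]
      push_cast
      ring_nf
  set V : Lp ℂ 2 (@AddCircle.haarAddCircle 1 _) := fourierBasis.repr.symm v with hV
  have hVn : ∀ n, fourierCoeff V n = v n := fun n => by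
    rw [← fourierBasis_repr, hV, LinearIsometryEquiv.apply_symm_apply]
  have hVm : MemLp V 2 (@AddCircle.haarAddCircle 1 _) := Lp.memLp V
  have hGV : MemLp (fun x => (∑' k, g k * fourier k x) * V x) 2 (@AddCircle.haarAddCircle 1 _) := by
    refine hVm.of_le_mul (c := ∑' k, ‖g k‖)
      ((continuous_tsum_fourier hg).aestronglyMeasurable.mul hVm.1) (.of_forall fun x => ?_)
    rw [norm_mul]
    gcongr
    exact norm_tsum_fourier_le hg x
  have h1 := hasSum_sq_fourierCoeff hGV.toLp
  have h2 := hasSum_sq_fourierCoeff V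
  simp only [hVn] at h2
  simp only [fourierCoeff_congr_ae hGV.coeFn_toLp,
    fourierCoeff_tsum_fourier_mul hg (hVm.integrable (by norm_num)), hVn, ← conv_apply hg] at h1
  have h3 := (norm_sq_eq v).trans h2.tsum_eq
  have h4 := (norm_sq_eq (conv g v)).trans h1.tsum_eq
  refine le_of_sq_le_sq ?_ (norm_nonneg _)
  rw [mul_pow, h3, h4, ← integral_const_mul]
  have hi1 : Integrable (fun x => ‖V x‖ ^ 2) (@AddCircle.haarAddCircle 1 _) :=
    hVm.integrable_norm_pow (by norm_num)
  have hi2 : Integrable (fun x => ‖hGV.toLp _ x‖ ^ 2) (@AddCircle.haarAddCircle 1 _) :=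
    (Lp.memLp hGV.toLp).integrable_norm_pow (by norm_num)
  refine integral_mono_ae (hi1.const_mul _) hi2 ?_
  filter_upwards [hGV.coeFn_toLp] with x hx
  simp only [hx, norm_mul, ← mul_pow]
  gcongr
  exact hlow' x

end L2Z

theorem one_le_wt (j : ℤ) : 1 ≤ wt j := le_max_left _ _

theorem wt_pos (j : ℤ) : 0 < wt j := zero_lt_one.trans_le (one_le_wt j)

theorem summable_wt_rpow_neg {b : ℝ} (hb : 1 < b) : Summable fun j : ℤ => wt j ^ (-b) := by
  refine Summable.of_nonneg_of_le (fun j => (Real.rpow_pos_of_pos (wt_pos j) _).le) (fun j => ?_)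
    ((Real.summable_abs_int_rpow hb).add (hasSum_ite_eq (0 : ℤ) (1 : ℝ)).summable)
  by_cases hj : j = 0
  · simp only [hj, wt]
    norm_num
    positivity
  · have h1 : (1 : ℝ) ≤ |(j : ℝ)| := by exact_mod_cast Int.one_le_abs hj
    simp [hj, wt, h1]

theorem hsumm.summable_norm {t : ℝ} (ht : 1 ≤ t) {u : ℤ → ℂ} (hu : hsumm t u) :
    Summable fun j => ‖u j‖ := by
  refine Summable.of_nonneg_of_le (fun j => norm_nonneg _) (fun j => ?_)
    (Summable.add hu (summable_wt_rpow_neg (b := 2 * t) (by linarith)))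
  have h := Real.rpow_pos_of_pos (wt_pos j) t
  have h2 : wt j ^ (2 * t) = (wt j ^ t) ^ 2 := by
    rw [← Real.rpow_natCast, ← Real.rpow_mul (wt_pos j).le]; congr 1; push_cast; ring
  have h3 : wt j ^ (-(2 * t)) = (wt j ^ t)⁻¹ ^ 2 := by
    rw [Real.rpow_neg (wt_pos j).le, h2, inv_pow]
  rw [h2, h3]
  have h4 : ‖u j‖ = (‖u j‖ * wt j ^ t) * (wt j ^ t)⁻¹ := by field_simp
  have h5 : 0 ≤ ‖u j‖ := norm_nonneg _
  have h6 : 0 < (wt j ^ t)⁻¹ := by positivity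
  nlinarith [sq_nonneg (‖u j‖ * wt j ^ t - (wt j ^ t)⁻¹)]

theorem hsumm_zero_iff {u : ℤ → ℂ} : hsumm 0 u ↔ Summable fun n => ‖u n‖ ^ 2 := by
  simp [hsumm]

theorem cmul_apply' (g u : ℤ → ℂ) (n : ℤ) : cmul g u n = ∑' k, g k * u (n - k) := by
  rw [cmul, ← (Equiv.subLeft n).tsum_eq]
  simp

theorem cmul_comm (g u : ℤ → ℂ) : cmul g u = cmul u g := by
  ext n
  rw [cmul_apply', cmul]
  simp only [mul_comm]

theorem Cmn_eq_indicator (u : ℤ → ℂ) : Cmn u = -(Set.Iio 0).indicator u := by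
  ext n
  by_cases hn : n < 0 <;> simp [Cmn, hn]

theorem Cpl_eq_indicator (u : ℤ → ℂ) : Cpl u = (Set.Ici 0).indicator u := by
  ext n
  by_cases hn : 0 ≤ n <;> simp [Cpl, hn]

section Convolution

variable {g : ℤ → ℂ} (hg : Summable fun k => ‖g k‖)
include hg

omit hg in
theorem summable_mul_of_bounded {ι : Type*} {f x : ι → ℂ} (hf : Summable fun k => ‖f k‖)
    {B : ℝ} (hx : ∀ k, ‖x k‖ ≤ B) : Summable fun k => f k * x k := by
  refine Summable.of_norm_bounded (hf.mul_right B) (fun k => ?_)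
  rw [norm_mul]
  gcongr
  exact hx k

theorem cmul_add {u v : ℤ → ℂ} {A B : ℝ} (hu : ∀ k, ‖u k‖ ≤ A) (hv : ∀ k, ‖v k‖ ≤ B) :
    cmul g (u + v) = cmul g u + cmul g v := by
  ext n
  simp only [cmul_apply', Pi.add_apply, mul_add]
  exact (summable_mul_of_bounded hg fun k => hu _).tsum_add
    (summable_mul_of_bounded hg fun k => hv _)

omit hg in
theorem cmul_neg (g u : ℤ → ℂ) : cmul g (-u) = -cmul g u := by
  ext n
  simp [cmul_apply', tsum_neg]

omit hg in
theorem cmul_smul (g : ℤ → ℂ) (a : ℂ) (u : ℤ → ℂ) : cmul g (a • u) = a • cmul g u := by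
  ext n
  simp only [cmul_apply', Pi.smul_apply, smul_eq_mul, ← tsum_mul_left]
  congr 1
  ext k
  ring

omit hg in
theorem cmul_one1 (g : ℤ → ℂ) : cmul g one1 = g := by
  ext n
  rw [cmul_comm, cmul_apply', tsum_eq_single 0]
  · simp [one1]
  · intro k hk
    simp [one1, hk]

omit hg in
theorem cmul_left_comm_of_summable {x y z : ℤ → ℂ}
    (h : ∀ n, Summable fun p : ℤ × ℤ => x p.1 * (y p.2 * z (n - p.1 - p.2))) :
    cmul x (cmul y z) = cmul y (cmul x z) := by
  ext n
  simp only [cmul_apply', ← tsum_mul_left]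
  refine (Summable.tsum_comm (f := fun k i => x k * (y i * z (n - k - i))) (h n)).symm.trans ?_
  congr 1
  ext k
  congr 1
  ext i
  rw [show n - i - k = n - k - i by ring]
  ring

theorem cmul_assoc_of_bounded {φ a : ℤ → ℂ} (hφ : Summable fun k => ‖φ k‖) {B : ℝ}
    (ha : ∀ k, ‖a k‖ ≤ B) : cmul (cmul g φ) a = cmul φ (cmul g a) := by
  have hgφ : Summable fun p : ℤ × ℤ => ‖g p.1 * φ p.2‖ := hg.mul_norm hφ
  rw [cmul_comm, cmul_left_comm_of_summable, cmul_comm a, cmul_left_comm_of_summable]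
  · intro n
    have := summable_mul_of_bounded hgφ (x := fun p => a (n - p.1 - p.2)) fun _ => ha _
    simpa only [mul_assoc] using this
  · intro n
    let e : ℤ × ℤ ≃ ℤ × ℤ :=
      { toFun := fun p => (p.2, n - p.1 - p.2)
        invFun := fun p => (n - p.1 - p.2, p.1)
        left_inv := fun p => by ext <;> simp
        right_inv := fun p => Prod.ext rfl (by dsimp only; ring) }
    have h1 := summable_mul_of_bounded (e.summable_iff.2 hgφ) (x := fun p => a p.1)
      fun _ => ha _
    refine h1.congr fun p => ?_
    simp only [e, Equiv.coe_fn_mk]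
    ring

end Convolution

namespace L2Z

theorem sio_apply {g : ℤ → ℂ} (hg : Summable fun k => ‖g k‖) (S : Set ℤ) (v : L2Z) (n : ℤ) :
    sio g S v n = Sᶜ.indicator v n + cmul g (S.indicator v) n := by
  simp [sio, proj_apply, conv_apply hg, cmul_apply']

theorem norm_indicator_apply_le (S : Set ℤ) (v : L2Z) (n : ℤ) : ‖S.indicator v n‖ ≤ ‖v‖ :=
  (norm_indicator_le_norm_self _ _).trans (norm_apply_le v n)

theorem sio_Iio_injective {g : ℤ → ℂ} (hg : Summable fun k => ‖g k‖) {u : ℤ → ℂ}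
    (hu0 : hsumm 0 u) (hueq : Cpl u - cmul g (Cmn u) = g - one1)
    (huniq : ∀ u' : ℤ → ℂ, hsumm 0 u' → Cpl u' - cmul g (Cmn u') = g - one1 → u' = u)
    {v : L2Z} (hv : sio g (Set.Iio 0) v = 0) : v = 0 := by
  let U : L2Z := mk u (hsumm_zero_iff.1 hu0)
  have h1 : ((U + v : L2Z) : ℤ → ℂ) = u := by
    refine huniq _ (hsumm_zero_iff.2 (summable_sq _)) ?_
    have h2 : ∀ w : L2Z, Cpl w - cmul g (Cmn w) = sio g (Set.Iio 0) w := fun w => by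
      ext n
      rw [sio_apply hg, Cpl_eq_indicator, Cmn_eq_indicator, cmul_neg, Set.compl_Iio]
      simp
    rw [h2, map_add, hv, add_zero, ← h2]
    exact hueq
  have h3 : U + v = U := Subtype.ext h1
  simpa using h3

theorem sio_Ici_injective {g : ℤ → ℂ} (hg : Summable fun k => ‖g k‖)
    (hconv : ∀ v, conv g v = 0 → v = 0) {u : ℤ → ℂ} (hu : Summable fun k => ‖u k‖)
    (hueq : Cpl u - cmul g (Cmn u) = g - one1)
    {v : L2Z} (hv : sio g (Set.Ici 0) v = 0) : v = 0 := by
  classical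
  have hCm : Summable fun k => ‖Cmn u k‖ := by
    refine Summable.of_nonneg_of_le (fun k => norm_nonneg _) (fun k => ?_) hu
    unfold Cmn
    split_ifs <;> simp
  have hone : Summable fun k => ‖one1 k‖ := by
    refine summable_of_ne_finset_zero (s := {0}) fun k hk => ?_
    simp only [Finset.mem_singleton] at hk
    simp [one1, hk]
  have hbdd : ∀ {x : ℤ → ℂ}, (Summable fun k => ‖x k‖) → ∀ k, ‖x k‖ ≤ ∑' k, ‖x k‖ :=
    fun hx k => hx.le_tsum k fun _ _ => norm_nonneg _
  set φm : ℤ → ℂ := one1 + Cmn u with hφm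
  set φp : ℤ → ℂ := one1 + Cpl u with hφp
  have hφs : Summable fun k => ‖φm k‖ :=
    Summable.of_nonneg_of_le (fun k => norm_nonneg _) (fun k => norm_add_le _ _) (hone.add hCm)
  have hφ : cmul g φm = φp := by
    rw [hφm, cmul_add hg (hbdd hone) (hbdd hCm), cmul_one1, hφp]
    have h1 : g = Cpl u - cmul g (Cmn u) + one1 := by rw [hueq]; abel
    nth_rw 1 [h1]
    abel
  set a : ℤ → ℂ := (Set.Ici 0).indicator v with ha
  have hm : ∀ n, (Set.Iio 0).indicator v n + cmul g a n = 0 := fun n => by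
    have := sio_apply hg (Set.Ici 0) v n
    rw [hv, Set.compl_Ici] at this
    simpa using this.symm
  have hassoc : cmul φp a = cmul φm (cmul g a) := by
    rw [← hφ]
    exact cmul_assoc_of_bounded hg hφs (norm_indicator_apply_le _ _)
  have hmnn : ∀ n, 0 ≤ n → cmul g a n = 0 := fun n hn => by
    simpa [hn] using hm n
  have hmneg : ∀ d : ℕ, cmul g a (-1 - d) = 0 := by
    intro d
    induction d using Nat.strong_induction_on with
    | _ d ih =>
      have h1 := congrFun hassoc (-1 - d)
      rw [cmul_apply', cmul_apply'] at h1
      rw [tsum_eq_single (0 : ℤ)] at h1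
      · rw [tsum_eq_single (0 : ℤ)] at h1
        · have h2 : ¬ (0 : ℤ) ≤ -1 - d := by omega
          have h3 : a (-1 - d - 0) = 0 := Set.indicator_of_notMem (by simpa using h2) _
          rw [h3, mul_zero] at h1
          simpa [hφm, one1, Cmn] using h1.symm
        · intro k hk
          rcases lt_or_gt_of_ne hk with hk | hk
          · have h2 : cmul g a (-1 - d - k) = 0 := by
              rcases le_or_gt 0 (-1 - (d : ℤ) - k) with h | h
              · exact hmnn _ h
              · have := ih (-1 - (-1 - (d : ℤ) - k)).toNat (by omega)
                rwa [show (-1 : ℤ) - ((-1 - (-1 - (d : ℤ) - k)).toNat : ℤ) = -1 - d - k by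
                  omega] at this
            rw [h2, mul_zero]
          · simp [hφm, one1, Cmn, hk.ne', hk.not_gt]
      · intro k hk
        rcases lt_or_gt_of_ne hk with hk | hk
        · simp [hφp, one1, Cpl, hk.ne, hk.not_ge]
        · have : ¬ (0 : ℤ) ≤ -1 - d - k := by omega
          rw [ha, Set.indicator_of_notMem (by simpa using this), mul_zero]
  have hm0 : ∀ n, cmul g a n = 0 := fun n => by
    rcases le_or_gt 0 n with h | h
    · exact hmnn n h
    · have := hmneg (-1 - n).toNat
      rwa [show (-1 : ℤ) - ((-1 - n).toNat : ℤ) = n by omega] at this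
  have hproj : proj (Set.Ici 0) v = 0 := by
    refine hconv _ ?_
    ext n
    rw [conv_apply hg, ← cmul_apply']
    refine Eq.trans ?_ (hm0 n)
    congr 1
    ext k
    exact proj_apply _ _ _
  ext n
  rcases le_or_gt 0 n with h | h
  · have h1 := proj_apply (Set.Ici 0) v n
    rw [hproj] at h1
    simpa [h] using h1.symm
  · simpa [hm0, h] using hm n

end L2Z

/-- Both the singular integral operator of the Riemann–Hilbert problem and its reflection are
bounded below. -/
theorem exists_norm_le_sio_Iio_Ici {g u : ℤ → ℂ} (hg : Summable fun k => ‖g k‖)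
    (hnv : nonvanishing g) (hu : Summable fun k => ‖u k‖) (hu0 : hsumm 0 u)
    (hueq : Cpl u - cmul g (Cmn u) = g - one1)
    (huniq : ∀ u' : ℤ → ℂ, hsumm 0 u' → Cpl u' - cmul g (Cmn u') = g - one1 → u' = u) :
    ∃ c, 0 < c ∧ (∀ v, ‖v‖ ≤ c * ‖L2Z.sio g (Set.Iio 0) v‖) ∧
      ∀ v, ‖v‖ ≤ c * ‖L2Z.sio g (Set.Ici 0) v‖ := by
  obtain ⟨ε, hε, hlow⟩ := L2Z.exists_norm_le_conv hg hnv
  have hconv : ∀ v, L2Z.conv g v = 0 → v = 0 := fun v hv => by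
    have := hlow v
    rw [hv, norm_zero] at this
    exact norm_le_zero_iff.1 (by nlinarith [norm_nonneg v])
  obtain ⟨c₁, hc₁, h₁⟩ := L2Z.exists_norm_le_sio hg hε hlow (Set.Iio 0)
    (fun k => (Set.finite_Ico 0 k).subset fun n hn => by
      simp only [Set.mem_ofPred_eq, Set.mem_Iio, Set.mem_Ico] at hn ⊢; omega)
    fun v hv => L2Z.sio_Iio_injective hg hu0 hueq huniq hv
  obtain ⟨c₂, hc₂, h₂⟩ := L2Z.exists_norm_le_sio hg hε hlow (Set.Ici 0)
    (fun k => (Set.finite_Ico k 0).subset fun n hn => by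
      simp only [Set.mem_ofPred_eq, Set.mem_Ici, Set.mem_Ico] at hn ⊢; omega)
    fun v hv => L2Z.sio_Ici_injective hg hconv hu hueq hv
  refine ⟨max c₁ c₂, lt_max_of_lt_left hc₁, fun v => (h₁ v).trans ?_, fun v => (h₂ v).trans ?_⟩
  · gcongr; exact le_max_left _ _
  · gcongr; exact le_max_right _ _

open Filter Topology

/-- The squared `ℓ²` norm of a sequence over the window `[a, a + N)`. -/
def perSq (N : ℕ) (a : ℤ) (W : ℤ → ℂ) : ℝ := ∑ n ∈ Finset.Ico a (a + N), ‖W n‖ ^ 2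

theorem perSq_nonneg (N : ℕ) (a : ℤ) (W : ℤ → ℂ) : 0 ≤ perSq N a W :=
  Finset.sum_nonneg fun _ _ => by positivity

theorem perSq_mono {N : ℕ} {a : ℤ} {V W : ℤ → ℂ} (h : ∀ n, ‖V n‖ ≤ ‖W n‖) :
    perSq N a V ≤ perSq N a W :=
  Finset.sum_le_sum fun n _ => by gcongr; exact h n

theorem perSq_shift (N : ℕ) (a b : ℤ) (W : ℤ → ℂ) :
    perSq N a (fun n => W (n + b)) = perSq N (a + b) W := by
  unfold perSq
  have h : Finset.Ico (a + b) (a + b + N) =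
      (Finset.Ico a (a + N)).map (addRightEmbedding b) := by
    rw [Finset.map_add_right_Ico, add_right_comm]
  rw [h, Finset.sum_map]
  rfl

theorem perSq_succ {N : ℕ} {W : ℤ → ℂ} (hW : ∀ n, W (n + N) = W n) (a : ℤ) :
    perSq N (a + 1) W = perSq N a W := by
  rcases Nat.eq_zero_or_pos N with rfl | hN
  · simp [perSq]
  have h1 : Finset.Ico a (a + N) = insert a (Finset.Ico (a + 1) (a + N)) := by
    ext n; simp only [Finset.mem_Ico, Finset.mem_insert]; omega
  have h2 : Finset.Ico (a + 1) (a + 1 + N) = insert (a + N) (Finset.Ico (a + 1) (a + N)) := by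
    ext n; simp only [Finset.mem_Ico, Finset.mem_insert]; omega
  rw [perSq, perSq, h1, h2, Finset.sum_insert (by simp), Finset.sum_insert (by simp), hW]

theorem perSq_eq {N : ℕ} {W : ℤ → ℂ} (hW : ∀ n, W (n + N) = W n) (a b : ℤ) :
    perSq N a W = perSq N b W := by
  have h : ∀ a : ℤ, perSq N a W = perSq N 0 W := fun a => by
    induction a using Int.induction_on with
    | zero => rfl
    | succ i ih => rw [perSq_succ hW, ih]
    | pred i ih => rw [← ih, ← perSq_succ hW, sub_add_cancel]
  rw [h a, h b]

theorem hasSum_ite_mem_finset (s : Finset ℤ) (f : ℤ → ℝ) :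
    HasSum (fun n => if n ∈ s then f n else 0) (∑ n ∈ s, f n) := by
  have h : HasSum (fun n => if n ∈ s then f n else 0) (∑ n ∈ s, if n ∈ s then f n else 0) :=
    hasSum_sum_of_ne_finset_zero fun n hn => by simp [hn]
  rwa [Finset.sum_congr rfl fun n hn => if_pos hn] at h

/-- Modulus controlling the commutator of `conv g` with a cutoff at scale `N`. -/
def commModulus (g : ℤ → ℂ) (N : ℕ) : ℝ := ∑' k, ‖g k‖ * min 1 (2 * |(k : ℝ)| / N)

theorem tendsto_commModulus {g : ℤ → ℂ} (hg : Summable fun k => ‖g k‖) :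
    Tendsto (commModulus g) atTop (𝓝 0) := by
  have h := tendsto_tsum_of_dominated_convergence (𝓕 := (atTop : Filter ℕ))
    (f := fun N k => ‖g k‖ * min 1 (2 * |(k : ℝ)| / N)) (g := fun _ => (0 : ℝ)) hg
    (fun k => by
      have h1 : Tendsto (fun N : ℕ => 2 * |(k : ℝ)| / N) atTop (𝓝 0) :=
        tendsto_const_nhds.div_atTop tendsto_natCast_atTop_atTop
      simpa using ((tendsto_const_nhds (x := (1 : ℝ))).min h1).const_mul ‖g k‖)
    (.of_forall fun N k => by
      have : 0 ≤ min 1 (2 * |(k : ℝ)| / N) := le_min zero_le_one (by positivity)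
      rw [Real.norm_of_nonneg (by positivity)]
      exact mul_le_of_le_one_right (norm_nonneg _) (min_le_left _ _))
  simp only [tsum_zero] at h
  exact h

section Localization

variable {g : ℤ → ℂ} (hg : Summable fun k => ‖g k‖) {N : ℕ}

theorem norm_commutator_term {X : ℤ → ℂ} (hX : ∀ n, X (n + N) = X n) {a : ℤ} {χ : ℤ → ℝ}
    (h0 : ∀ n, 0 ≤ χ n) (h1 : ∀ n, χ n ≤ 1) (hsupp : ∀ n, χ n ≠ 0 → n ∈ Finset.Ico a (a + N))
    (hlip : ∀ n k : ℤ, |χ (n - k) - χ n| ≤ 2 * |(k : ℝ)| / N) (k : ℤ) :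
    ∃ ρ : L2Z, (∀ n, ρ n = g k * (((χ (n - k) - χ n : ℝ) : ℂ) * X (n - k))) ∧
      ‖ρ‖ ≤ ‖g k‖ * min 1 (2 * |(k : ℝ)| / N) * (2 * √(perSq N a X)) := by
  classical
  set m := min 1 (2 * |(k : ℝ)| / N) with hm
  have hm0 : 0 ≤ m := le_min zero_le_one (by positivity)
  have hm' : ∀ n, |χ (n - k) - χ n| ≤ m := fun n => le_min
    (abs_le.2 ⟨by linarith [h0 (n - k), h1 n], by linarith [h0 n, h1 (n - k)]⟩) (hlip n k)
  have hsum : HasSum (fun n => (‖g k‖ * m) ^ 2 *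
      ((if n ∈ Finset.Ico a (a + N) then ‖X (n - k)‖ ^ 2 else 0) +
        (if n - k ∈ Finset.Ico a (a + N) then ‖X (n - k)‖ ^ 2 else 0)))
      ((‖g k‖ * m) ^ 2 * (perSq N a X + perSq N a X)) := by
    refine HasSum.mul_left _ (HasSum.add ?_ ?_)
    · have hper : perSq N a X = ∑ n ∈ Finset.Ico a (a + N), ‖X (n - k)‖ ^ 2 := by
        rw [perSq_eq hX a (a + -k), ← perSq_shift]
        simp only [perSq, sub_eq_add_neg]
      rw [hper]
      exact hasSum_ite_mem_finset _ _
    · have h := (Equiv.subRight k).hasSum_iff.2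
        (hasSum_ite_mem_finset (Finset.Ico a (a + N)) (fun n => ‖X n‖ ^ 2))
      simp only [Function.comp_def, Equiv.subRight_apply] at h
      exact h
  have hle : ∀ n, ‖g k * (((χ (n - k) - χ n : ℝ) : ℂ) * X (n - k))‖ ^ 2 ≤ (‖g k‖ * m) ^ 2 *
      ((if n ∈ Finset.Ico a (a + N) then ‖X (n - k)‖ ^ 2 else 0) +
        (if n - k ∈ Finset.Ico a (a + N) then ‖X (n - k)‖ ^ 2 else 0)) := by
    intro n
    by_cases hz : χ (n - k) = 0 ∧ χ n = 0
    · simp only [hz.1, hz.2, sub_zero, Complex.ofReal_zero, zero_mul, mul_zero, norm_zero]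
      rw [zero_pow two_ne_zero]
      positivity
    · have h2 : ‖X (n - k)‖ ^ 2 ≤ (if n ∈ Finset.Ico a (a + N) then ‖X (n - k)‖ ^ 2 else 0) +
          (if n - k ∈ Finset.Ico a (a + N) then ‖X (n - k)‖ ^ 2 else 0) := by
        rw [not_and_or] at hz
        rcases hz with hz | hz
        · rw [if_pos (hsupp _ hz)]
          exact le_add_of_nonneg_left (by positivity)
        · rw [if_pos (hsupp _ hz)]
          exact le_add_of_nonneg_right (by positivity)
      rw [norm_mul, norm_mul, Complex.norm_real, Real.norm_eq_abs, ← mul_assoc, mul_pow]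
      gcongr
      exact hm' n
  have hs := Summable.of_nonneg_of_le (fun n => by positivity) hle hsum.summable
  refine ⟨L2Z.mk _ hs, fun n => rfl, ?_⟩
  refine L2Z.norm_le_of_tsum_le (by positivity) ?_
  calc _ ≤ (‖g k‖ * m) ^ 2 * (perSq N a X + perSq N a X) :=
        (hs.tsum_le_tsum hle hsum.summable).trans hsum.tsum_eq.le
    _ ≤ _ := by
        rw [mul_pow (‖g k‖ * m) (2 * √(perSq N a X)), mul_pow 2, Real.sq_sqrt (perSq_nonneg _ _ _)]
        gcongr
        linarith [perSq_nonneg N a X]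

include hg

/-- Local stability: the periodic operator is controlled on a window where it agrees with a
singular integral operator that is bounded below. -/
theorem sqrt_perSq_cutoff_le {S : Set ℤ} {c : ℝ} (hc : 0 < c)
    (hS : ∀ v, ‖v‖ ≤ c * ‖L2Z.sio g S v‖) {W X F : ℤ → ℂ} (hX : ∀ n, X (n + N) = X n)
    {B : ℝ} (hXB : ∀ n, ‖X n‖ ≤ B) (hF : ∀ n, F n = W n - X n + cmul g X n) {a : ℤ} {χ : ℤ → ℝ}
    (hXS : ∀ n ∈ Finset.Ico a (a + N), X n = S.indicator W n)
    (h0 : ∀ n, 0 ≤ χ n) (h1 : ∀ n, χ n ≤ 1) (hsupp : ∀ n, χ n ≠ 0 → n ∈ Finset.Ico a (a + N))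
    (hlip : ∀ n k : ℤ, |χ (n - k) - χ n| ≤ 2 * |(k : ℝ)| / N) :
    √(perSq N a fun n => (χ n : ℂ) * W n) ≤
      c * (√(perSq N a F) + 2 * commModulus g N * √(perSq N a X)) := by
  classical
  have hmk : ∀ Y : ℤ → ℂ, HasSum (fun n => ‖(χ n : ℂ) * Y n‖ ^ 2)
      (perSq N a fun n => (χ n : ℂ) * Y n) := fun Y => by
    refine hasSum_sum_of_ne_finset_zero fun n hn => ?_
    have : χ n = 0 := by
      by_contra h
      exact hn (hsupp n h)
    simp [this]
  have hnorm : ∀ Y : ℤ → ℂ, ‖L2Z.mk _ (hmk Y).summable‖ =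
      √(perSq N a fun n => (χ n : ℂ) * Y n) := fun Y => by
    rw [← Real.sqrt_sq (norm_nonneg _), L2Z.norm_sq_eq]
    congr 1
    exact (hmk Y).tsum_eq
  choose ρ hρ hρn using norm_commutator_term (g := g) hX h0 h1 hsupp hlip
  have hb : Summable fun k => ‖g k‖ * min 1 (2 * |(k : ℝ)| / N) := by
    refine Summable.of_nonneg_of_le (fun k => ?_) (fun k => ?_) hg
    · have : 0 ≤ min 1 (2 * |(k : ℝ)| / N) := le_min zero_le_one (by positivity)
      positivity
    · exact mul_le_of_le_one_right (norm_nonneg _) (min_le_left _ _)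
  have hb' := hb.hasSum.mul_right (2 * √(perSq N a X))
  have hρs : Summable ρ := Summable.of_norm_bounded hb'.summable hρn
  have hR : ‖∑' k, ρ k‖ ≤ commModulus g N * (2 * √(perSq N a X)) :=
    tsum_of_norm_bounded hb' hρn
  have hind : ∀ n, S.indicator (fun n => (χ n : ℂ) * W n) n = (χ n : ℂ) * X n := fun n => by
    by_cases hn : n ∈ Finset.Ico a (a + N)
    · rw [hXS n hn]
      by_cases h : n ∈ S <;> simp [h]
    · have : χ n = 0 := by
        by_contra h
        exact hn (hsupp n h)
      simp [this, Set.indicator_apply]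
  have key : L2Z.sio g S (L2Z.mk _ (hmk W).summable) = L2Z.mk _ (hmk F).summable + ∑' k, ρ k := by
    ext n
    rw [L2Z.sio_apply hg, lp.coeFn_add, Pi.add_apply, L2Z.tsum_apply hρs, L2Z.mk_apply]
    have e1 : (S.indicator (L2Z.mk _ (hmk W).summable) : ℤ → ℂ) = fun n => (χ n : ℂ) * X n :=
      funext hind
    have e2 : (Sᶜ.indicator (L2Z.mk _ (hmk W).summable) : ℤ → ℂ) n =
        (χ n : ℂ) * W n - (χ n : ℂ) * X n := by
      have := congrFun (Set.indicator_compl S (L2Z.mk _ (hmk W).summable : ℤ → ℂ)) n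
      rw [this, Pi.sub_apply, e1]
      rfl
    rw [e1, e2, hF, cmul_apply', cmul_apply']
    simp only [hρ]
    have s1 : Summable fun k => g k * X (n - k) := summable_mul_of_bounded hg fun _ => hXB _
    have s2 : Summable fun k => g k * (((χ (n - k) - χ n : ℝ) : ℂ) * X (n - k)) := by
      refine summable_mul_of_bounded hg (B := B) fun k => ?_
      rw [norm_mul, Complex.norm_real, Real.norm_eq_abs]
      refine (mul_le_of_le_one_left (norm_nonneg _) ?_).trans (hXB _)
      exact abs_le.2 ⟨by linarith [h0 (n - k), h1 n], by linarith [h0 n, h1 (n - k)]⟩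
    have e3 : ∑' k, g k * ((χ (n - k) : ℂ) * X (n - k)) =
        (χ n : ℂ) * ∑' k, g k * X (n - k) +
          ∑' k, g k * (((χ (n - k) - χ n : ℝ) : ℂ) * X (n - k)) := by
      rw [← tsum_mul_left, ← (s1.mul_left _).tsum_add s2]
      congr 1
      ext k
      push_cast
      ring
    rw [e3]
    ring
  rw [← hnorm W]
  refine (hS _).trans ?_
  rw [key]
  gcongr
  refine (norm_add_le _ _).trans ?_
  rw [hnorm F]
  gcongr ?_ + ?_
  · refine Real.sqrt_le_sqrt (perSq_mono fun n => ?_)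
    rw [norm_mul, Complex.norm_real, Real.norm_of_nonneg (h0 n)]
    exact mul_le_of_le_one_left (norm_nonneg _) (h1 n)
  · linarith

end Localization

/-- The representative of `n` modulo `N` in the window `[-N₋, N₊]`. -/
def rep (N : ℕ) (n : ℤ) : ℤ := (n + Nmin N) % N - Nmin N

theorem rep_add (N : ℕ) (n : ℤ) : rep N (n + N) = rep N n := by
  unfold rep
  rw [show n + N + Nmin N = n + Nmin N + N by ring, Int.add_emod_right]

theorem rep_of_mem {N : ℕ} {n : ℤ} (hn : -Nmin N ≤ n ∧ n ≤ Npl N) : rep N n = n := by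
  unfold rep
  rw [Int.emod_eq_of_lt (by omega) (by unfold Nmin Npl at *; omega)]
  ring

theorem neg_Nmin_add (N : ℕ) : -Nmin N + N = Npl N + 1 := by
  unfold Nmin Npl
  omega

/-- The tent function of height one supported on `[-N/2, N/2]`. -/
def tent (N : ℕ) (x : ℝ) : ℝ := max 0 (1 - 2 * |x| / N)

theorem tent_nonneg (N : ℕ) (x : ℝ) : 0 ≤ tent N x := le_max_left _ _

theorem tent_le_one (N : ℕ) (x : ℝ) : tent N x ≤ 1 :=
  max_le zero_le_one (sub_le_self 1 (by positivity))

theorem abs_tent_sub_le (N : ℕ) (x y : ℝ) : |tent N x - tent N y| ≤ 2 * |x - y| / N := by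
  unfold tent
  refine (abs_max_sub_max_le_max (0 : ℝ) (1 - 2 * |x| / N) 0 (1 - 2 * |y| / N)).trans
    (max_le (by rw [sub_self, abs_zero]; positivity) ?_)
  rw [show 1 - 2 * |x| / N - (1 - 2 * |y| / N) = -(2 * (|x| - |y|) / N) by ring, abs_neg, abs_div,
    abs_mul, abs_two, Nat.abs_cast]
  exact div_le_div_of_nonneg_right
    (mul_le_mul_of_nonneg_left (abs_abs_sub_abs_le x y) zero_le_two) N.cast_nonneg

theorem lt_of_tent_ne_zero {N : ℕ} (hN : 0 < N) {x : ℝ} (hx : tent N x ≠ 0) : 2 * |x| < N := by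
  by_contra! h
  refine hx (max_eq_left ?_)
  have : (1 : ℝ) ≤ 2 * |x| / N := by rwa [le_div_iff₀ (by positivity), one_mul]
  linarith

/-- Stability of the periodic singular integral operators for large periods. -/
theorem exists_periodic_stability {g : ℤ → ℂ} (hg : Summable fun k => ‖g k‖) {c : ℝ} (hc : 0 < c)
    (h1 : ∀ v, ‖v‖ ≤ c * ‖L2Z.sio g (Set.Iio 0) v‖)
    (h2 : ∀ v, ‖v‖ ≤ c * ‖L2Z.sio g (Set.Ici 0) v‖) :
    ∃ N₀ : ℕ, ∀ N : ℕ, N₀ < N → ∀ W X F : ℤ → ℂ, (∀ n, W (n + N) = W n) →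
      (∀ n, X (n + N) = X n) → (∀ n, F (n + N) = F n) →
      (∀ n, -Nmin N ≤ n → n ≤ Npl N → X n = (Set.Iio 0).indicator W n) →
      (∃ B, ∀ n, ‖X n‖ ≤ B) → (∀ n, F n = W n - X n + cmul g X n) →
      ∀ a, √(perSq N a W) ≤ 4 * c * √(perSq N a F) := by
  have hη : ∀ᶠ N in atTop, commModulus g N < 1 / (8 * c) :=
    (tendsto_commModulus hg).eventually_lt_const (by positivity)
  obtain ⟨N₀, hN₀⟩ := eventually_atTop.1 hη
  refine ⟨N₀, fun N hN W X F hW hX hF hXW ⟨B, hB⟩ hFeq a => ?_⟩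
  have hNpos : 0 < N := by omega
  have hNr : (0 : ℝ) < N := by positivity
  set b : ℤ := Npl N + 1 with hb
  have hNm : -Nmin N + N = b := neg_Nmin_add N
  have hb1 : (N : ℤ) ≤ 2 * b := by unfold Npl at hb; omega
  have hb2 : 2 * b ≤ N + 1 := by unfold Npl at hb; omega
  -- the window around the index `0`
  have est1 := sqrt_perSq_cutoff_le hg (N := N) (a := -Nmin N) (χ := fun n => tent N n) hc h1 hX hB
    hFeq (fun n hn => by
      rw [Finset.mem_Ico] at hn
      exact hXW n (by omega) (by omega))
    (fun n => tent_nonneg _ _) (fun n => tent_le_one _ _)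
    (fun n hn => by
      have := lt_of_tent_ne_zero hNpos hn
      have h3 : 2 * |n| < N := by exact_mod_cast this
      rw [Finset.mem_Ico]
      rw [abs_eq_max_neg] at h3
      have := le_max_left n (-n)
      have := le_max_right n (-n)
      omega)
    (fun n k => by
      refine (abs_tent_sub_le _ _ _).trans (le_of_eq ?_)
      push_cast
      rw [sub_sub_cancel_left, abs_neg])
  -- the window around the index `N / 2`
  have est2 := sqrt_perSq_cutoff_le hg (N := N) (a := -b)
    (χ := fun n => tent N ((n + b : ℤ) - N / 2))
    (W := fun n => W (n + b)) (X := fun n => X (n + b)) (F := fun n => F (n + b)) hc h2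
    (fun n => by rw [← hX (n + b)]; congr 1; ring) (fun n => hB _)
    (fun n => by
      rw [hFeq, cmul_apply', cmul_apply']
      congr 2
      ext k
      congr 2
      ring)
    (fun n hn => by
      rw [Finset.mem_Ico] at hn
      rcases lt_or_ge n 0 with h | h
      · rw [hXW _ (by omega) (by omega), Set.indicator_of_notMem, Set.indicator_of_notMem]
        · simpa using h
        · simp only [Set.mem_Iio]; omega
      · have e1 := hX (n + b - N)
        have e2 := hW (n + b - N)
        rw [sub_add_cancel] at e1 e2
        rw [e1, hXW _ (by omega) (by omega),
          Set.indicator_of_mem (by simp only [Set.mem_Iio]; omega),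
          ← e2, Set.indicator_of_mem (by simpa using h)])
    (fun n => tent_nonneg _ _) (fun n => tent_le_one _ _)
    (fun n hn => by
      have := lt_of_tent_ne_zero hNpos hn
      have h3 := abs_lt.1 (show |((n + b : ℤ) : ℝ) - N / 2| < N / 2 by linarith)
      have h4 : (0 : ℝ) < (n + b : ℤ) := by linarith
      have h5 : ((n + b : ℤ) : ℝ) < (N : ℤ) := by push_cast at h3 ⊢; linarith
      have h6 : 0 < n + b := by exact_mod_cast h4
      have h7 : n + b < N := by exact_mod_cast h5
      rw [Finset.mem_Ico]
      omega)
    (fun n k => by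
      refine (abs_tent_sub_le _ _ _).trans (le_of_eq ?_)
      push_cast
      rw [show (n : ℝ) - k + b - N / 2 - (n + b - N / 2) = -k by ring, abs_neg])
  have hsh : ∀ Y : ℤ → ℂ, (∀ n, Y (n + N) = Y n) →
      perSq N (-b) (fun n => Y (n + b)) = perSq N a Y := fun Y hY => by
    rw [perSq_shift, perSq_eq hY]
  rw [hsh F hF, hsh X hX] at est2
  rw [perSq_eq hF _ a, perSq_eq hX _ a] at est1
  -- periodic cutoffs
  have hper : ∀ f : ℝ → ℝ, ∀ n, ((f (rep N (n + N)) : ℝ) : ℂ) * W (n + N) =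
      ((f (rep N n) : ℝ) : ℂ) * W n := fun f n => by rw [rep_add, hW]
  have e1 : (perSq N (-Nmin N) fun n => ((tent N n : ℝ) : ℂ) * W n) =
      perSq N a fun n => ((tent N (rep N n) : ℝ) : ℂ) * W n := by
    rw [perSq_eq (hper (tent N)) a (-Nmin N)]
    refine Finset.sum_congr rfl fun n hn => ?_
    rw [Finset.mem_Ico] at hn
    dsimp only
    rw [rep_of_mem (n := n) ⟨by omega, by omega⟩]
  have e2 : (perSq N (-b) fun n => ((tent N ((n + b : ℤ) - N / 2) : ℝ) : ℂ) * W (n + b)) =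
      perSq N a fun n => ((1 - tent N (rep N n) : ℝ) : ℂ) * W n := by
    rw [perSq_shift N (-b) b fun n => ((tent N ((n : ℝ) - N / 2) : ℝ) : ℂ) * W n, neg_add_cancel,
      perSq_eq (hper fun x => 1 - tent N x) a 0]
    refine Finset.sum_congr rfl fun n hn => ?_
    rw [Finset.mem_Ico, zero_add] at hn
    suffices h : tent N ((n : ℝ) - N / 2) = 1 - tent N (rep N n) by
      dsimp only
      rw [h]
    rcases lt_or_ge n b with h | h
    · rw [rep_of_mem (n := n) ⟨by omega, by omega⟩]
      have h3 : (0 : ℝ) ≤ n := by exact_mod_cast hn.1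
      have h4 : (2 : ℝ) * n ≤ N := by
        have : 2 * n ≤ N := by omega
        exact_mod_cast this
      unfold tent
      rw [abs_of_nonneg h3, abs_of_nonpos (by linarith), max_eq_right, max_eq_right]
      · field_simp; ring
      · rw [sub_nonneg, div_le_one hNr]; exact h4
      · rw [sub_nonneg, div_le_one hNr]; linarith
    · have h5 : rep N n = n - N := by
        have := rep_add N (n - N)
        rw [sub_add_cancel] at this
        rw [this, rep_of_mem (n := n - N) ⟨by omega, by omega⟩]
      rw [h5]
      have h3 : (n : ℝ) ≤ N := by
        have : n ≤ N := by omega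
        exact_mod_cast this
      have h4 : (N : ℝ) ≤ 2 * n := by
        have : (N : ℤ) ≤ 2 * n := by omega
        exact_mod_cast this
      unfold tent
      push_cast
      rw [abs_of_nonneg (by linarith), abs_of_nonpos (by linarith), max_eq_right, max_eq_right]
      · field_simp; ring
      · rw [sub_nonneg, div_le_one hNr]; linarith
      · rw [sub_nonneg, div_le_one hNr]; linarith
  rw [e1] at est1
  rw [e2] at est2
  have hsplit : perSq N a W ≤ 2 * ((perSq N a fun n => ((tent N (rep N n) : ℝ) : ℂ) * W n) +
      perSq N a fun n => ((1 - tent N (rep N n) : ℝ) : ℂ) * W n) := by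
    unfold perSq
    rw [← Finset.sum_add_distrib, Finset.mul_sum]
    refine Finset.sum_le_sum fun n _ => ?_
    rw [norm_mul, norm_mul, Complex.norm_real, Complex.norm_real, mul_pow, mul_pow,
      Real.norm_eq_abs, Real.norm_eq_abs, sq_abs, sq_abs]
    nlinarith [sq_nonneg (2 * tent N (rep N n) - 1), sq_nonneg ‖W n‖,
      mul_nonneg (sq_nonneg (2 * tent N (rep N n) - 1)) (sq_nonneg ‖W n‖)]
  have hXle : √(perSq N a X) ≤ √(perSq N a W) := by
    rw [perSq_eq hX a (-Nmin N), perSq_eq hW a (-Nmin N)]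
    refine Real.sqrt_le_sqrt (Finset.sum_le_sum fun n hn => ?_)
    rw [Finset.mem_Ico] at hn
    rw [hXW n (by omega) (by omega)]
    gcongr
    exact norm_indicator_le_norm_self _ _
  have hηN := hN₀ N hN.le
  have hη0 : 0 ≤ commModulus g N := tsum_nonneg fun k => by
    have : 0 ≤ min 1 (2 * |(k : ℝ)| / N) := le_min zero_le_one (by positivity)
    positivity
  set w := √(perSq N a W)
  set f := √(perSq N a F)
  set D := c * (f + 2 * commModulus g N * w) with hD
  have hf0 : 0 ≤ f := Real.sqrt_nonneg _
  have hw0 : 0 ≤ w := Real.sqrt_nonneg _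
  have hDb : c * (f + 2 * commModulus g N * √(perSq N a X)) ≤ D := by
    rw [hD]; gcongr
  have k1 := Real.sqrt_le_left (by positivity) |>.1 (est1.trans hDb)
  have k2 := Real.sqrt_le_left (by positivity) |>.1 (est2.trans hDb)
  have hw : w ≤ 2 * D := by
    refine Real.sqrt_le_iff.2 ⟨by positivity, ?_⟩
    nlinarith
  have hcη : c * commModulus g N ≤ 1 / 8 := by
    rw [lt_div_iff₀ (by positivity)] at hηN
    linarith
  have : c * commModulus g N * w ≤ 1 / 8 * w := by gcongr
  rw [hD] at hw
  linarith

/-- The operator `𝒞⁺ - 𝓜(g) 𝒞⁻` of the Riemann–Hilbert problem. -/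
def rhOp (g y : ℤ → ℂ) : ℤ → ℂ := Cpl y - cmul g (Cmn y)

theorem rhOp_eq (g y : ℤ → ℂ) :
    rhOp g y = y - (Set.Iio 0).indicator y + cmul g ((Set.Iio 0).indicator y) := by
  have h : Cpl y = y - (Set.Iio 0).indicator y := by
    rw [Cpl_eq_indicator, ← Set.indicator_compl, Set.compl_Iio]
  rw [rhOp, h, Cmn_eq_indicator, cmul_neg, sub_neg_eq_add]

theorem rhOp_eq_sub_cmul {g y : ℤ → ℂ} (hg : Summable fun k => ‖g k‖) {B : ℝ}
    (hy : ∀ k, ‖y k‖ ≤ B) : rhOp g y = y - cmul (g - one1) (Cmn y) := by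
  have hx : ∀ k, ‖(Set.Iio (0 : ℤ)).indicator y k‖ ≤ B := fun k =>
    (norm_indicator_le_norm_self _ _).trans (hy k)
  have ho : Summable fun k => ‖one1 k‖ := summable_of_ne_finset_zero (s := {0}) fun k hk => by
    simp [one1, Finset.mem_singleton.not.1 hk]
  have h : cmul (g - one1) ((Set.Iio 0).indicator y) =
      cmul g ((Set.Iio 0).indicator y) - (Set.Iio 0).indicator y := by
    ext n
    nth_rewrite 3 [← cmul_one1 ((Set.Iio 0).indicator y)]
    rw [cmul_comm _ one1]
    simp only [cmul_apply', Pi.sub_apply, sub_mul]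
    exact (summable_mul_of_bounded hg fun k => hx _).tsum_sub
      (summable_mul_of_bounded ho fun k => hx _)
  rw [rhOp_eq, Cmn_eq_indicator, cmul_neg, h]
  abel

theorem rhOp_sub {g x y : ℤ → ℂ} (hg : Summable fun k => ‖g k‖) {A B : ℝ}
    (hx : ∀ k, ‖x k‖ ≤ A) (hy : ∀ k, ‖y k‖ ≤ B) : rhOp g (x - y) = rhOp g x - rhOp g y := by
  simp only [rhOp_eq, sub_eq_add_neg, Set.indicator_add', Set.indicator_neg']
  rw [cmul_add hg (A := A) (B := B), cmul_neg]
  · abel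
  · exact fun k => (norm_indicator_le_norm_self _ _).trans (hx k)
  · intro k
    rw [Pi.neg_apply, norm_neg]
    exact (norm_indicator_le_norm_self _ _).trans (hy k)

theorem summable_norm_cmul {g y : ℤ → ℂ} (hg : Summable fun k => ‖g k‖)
    (hy : Summable fun k => ‖y k‖) : Summable fun k => ‖cmul g y k‖ := by
  have h : Summable fun p : ℤ × ℤ => ‖g p.2 * y (p.1 - p.2)‖ :=
    (hg.mul_norm hy).comp_injective (i := fun p : ℤ × ℤ => (p.2, p.1 - p.2)) fun p q hpq => by
      simp only [Prod.mk.injEq] at hpq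
      exact Prod.ext (by omega) hpq.1
  refine Summable.of_nonneg_of_le (fun _ => norm_nonneg _) (fun n => ?_) h.prod
  rw [cmul_apply']
  exact norm_tsum_le_tsum_norm (h.prod_factor n)

theorem summable_norm_indicator {y : ℤ → ℂ} (hy : Summable fun k => ‖y k‖) (S : Set ℤ) :
    Summable fun k => ‖S.indicator y k‖ :=
  Summable.of_nonneg_of_le (fun _ => norm_nonneg _) (fun _ => norm_indicator_le_norm_self _ _) hy

theorem summable_norm_sub {x y : ℤ → ℂ} (hx : Summable fun k => ‖x k‖)
    (hy : Summable fun k => ‖y k‖) : Summable fun k => ‖(x - y) k‖ :=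
  Summable.of_nonneg_of_le (fun _ => norm_nonneg _) (fun _ => norm_sub_le _ _) (hx.add hy)

theorem summable_norm_rhOp {g y : ℤ → ℂ} (hg : Summable fun k => ‖g k‖)
    (hy : Summable fun k => ‖y k‖) : Summable fun k => ‖rhOp g y k‖ := by
  rw [rhOp, Cpl_eq_indicator, Cmn_eq_indicator, cmul_neg, sub_neg_eq_add]
  exact Summable.of_nonneg_of_le (fun _ => norm_nonneg _) (fun _ => norm_add_le _ _)
    ((summable_norm_indicator hy _).add (summable_norm_cmul hg (summable_norm_indicator hy _)))

/-- The `N`-periodization of a sequence. -/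
def fold (N : ℕ) (y : ℤ → ℂ) (n : ℤ) : ℂ := ∑' p : ℤ, y (p * N + n)

section Fold

variable {N : ℕ}

theorem fold_add_period (N : ℕ) (y : ℤ → ℂ) (n : ℤ) : fold N y (n + N) = fold N y n := by
  rw [fold, fold, ← (Equiv.addRight (1 : ℤ)).tsum_eq fun p : ℤ => y (p * N + n)]
  congr 1
  ext p
  rw [Equiv.coe_addRight]
  congr 1
  ring

theorem interpI_of_mem {n : ℤ} (hn : -Nmin N ≤ n ∧ n ≤ Npl N) (y : ℤ → ℂ) :
    interpI N y n = fold N y n := if_pos hn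

theorem mul_add_injective (hN : 0 < N) (n : ℤ) : Function.Injective fun p : ℤ => p * N + n :=
  fun p q h => by
    have h1 : p * (N : ℤ) = q * N := add_right_cancel h
    exact mul_right_cancel₀ (by omega) h1

theorem norm_fold_le (hN : 0 < N) {y : ℤ → ℂ} (hy : Summable fun k => ‖y k‖) (n : ℤ) :
    ‖fold N y n‖ ≤ ∑' k, ‖y k‖ :=
  (norm_tsum_le_tsum_norm (hy.comp_injective (mul_add_injective hN n))).trans
    (tsum_comp_le_tsum_of_inj hy (fun _ => norm_nonneg _) (mul_add_injective hN n))

theorem fold_add (hN : 0 < N) {x y : ℤ → ℂ} (hx : Summable fun k => ‖x k‖)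
    (hy : Summable fun k => ‖y k‖) : fold N (x + y) = fold N x + fold N y := by
  ext n
  exact (hx.of_norm.comp_injective (mul_add_injective hN n)).tsum_add
    (hy.of_norm.comp_injective (mul_add_injective hN n))

theorem fold_sub (hN : 0 < N) {x y : ℤ → ℂ} (hx : Summable fun k => ‖x k‖)
    (hy : Summable fun k => ‖y k‖) : fold N (x - y) = fold N x - fold N y := by
  ext n
  exact (hx.of_norm.comp_injective (mul_add_injective hN n)).tsum_sub
    (hy.of_norm.comp_injective (mul_add_injective hN n))

theorem fold_cmul (hN : 0 < N) {g y : ℤ → ℂ} (hg : Summable fun k => ‖g k‖)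
    (hy : Summable fun k => ‖y k‖) : fold N (cmul g y) = cmul g (fold N y) := by
  ext n
  have h : Summable fun p : ℤ × ℤ => g p.2 * y (p.1 * N + n - p.2) :=
    (hg.mul_norm hy).of_norm.comp_injective
      (i := fun p : ℤ × ℤ => (p.2, p.1 * N + n - p.2)) fun p q hpq => by
        simp only [Prod.mk.injEq] at hpq
        obtain ⟨h1, h2⟩ := hpq
        rw [h1, sub_left_inj] at h2
        exact Prod.ext (mul_add_injective hN n h2) h1
  rw [cmul_apply', fold]
  simp only [cmul_apply']
  rw [← Summable.tsum_comm (f := fun p k => g k * y (p * N + n - k)) h]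
  congr 1
  ext k
  rw [tsum_mul_left, fold]
  congr 2
  ext p
  rw [add_sub_assoc]

theorem fold_rhOp (hN : 0 < N) {g y : ℤ → ℂ} (hg : Summable fun k => ‖g k‖)
    (hy : Summable fun k => ‖y k‖) :
    fold N (rhOp g y) = fold N y - fold N ((Set.Iio 0).indicator y) +
      cmul g (fold N ((Set.Iio 0).indicator y)) := by
  have hx := summable_norm_indicator hy (Set.Iio 0)
  rw [rhOp_eq, fold_add hN (summable_norm_sub hy hx) (summable_norm_cmul hg hx),
    fold_sub hN hy hx, fold_cmul hN hg hx]

theorem rep_mul_add (N : ℕ) (p n : ℤ) : rep N (p * N + n) = rep N n := by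
  unfold rep
  rw [show p * N + n + Nmin N = n + Nmin N + p * N by ring, Int.add_mul_emod_self_right]

theorem fold_of_support (hN : 0 < N) {x : ℤ → ℂ}
    (hx : ∀ n, ¬(-Nmin N ≤ n ∧ n ≤ Npl N) → x n = 0) (n : ℤ) : fold N x n = x (rep N n) := by
  have h0 : -((n + Nmin N) / N) * N + n = rep N n := by
    have := Int.emod_add_mul_ediv (n + Nmin N) N
    unfold rep
    linarith
  rw [fold, tsum_eq_single (-((n + Nmin N) / N)), h0]
  intro p hp
  refine hx _ fun hm => hp ?_
  have h1 := rep_of_mem hm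
  rw [rep_mul_add, ← h0] at h1
  exact (mul_add_injective hN n h1).symm

end Fold

theorem inPN_iff {N : ℕ} {w : ℤ → ℂ} :
    inPN N w ↔ ∀ n, ¬(-Nmin N ≤ n ∧ n ≤ Npl N) → w n = 0 := by
  refine ⟨fun h n hn => ?_, fun h => funext fun n => ?_⟩
  · rw [← h, projP, if_neg hn]
  · by_cases hn : -Nmin N ≤ n ∧ n ≤ Npl N
    · exact if_pos hn
    · rw [h n hn, projP, if_neg hn]

theorem inPN.summable_norm {N : ℕ} {w : ℤ → ℂ} (hw : inPN N w) : Summable fun k => ‖w k‖ :=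
  summable_of_ne_finset_zero (s := Finset.Icc (-Nmin N) (Npl N)) fun n hn => by
    rw [inPN_iff.1 hw n (by rwa [Finset.mem_Icc] at hn), norm_zero]

theorem norm_le_tsum_norm {w : ℤ → ℂ} (hw : Summable fun k => ‖w k‖) (n : ℤ) :
    ‖w n‖ ≤ ∑' k, ‖w k‖ := hw.le_tsum n fun _ _ => norm_nonneg _

theorem sub_interpI_apply {N : ℕ} (hN : 0 < N) {g w : ℤ → ℂ} (hg : Summable fun k => ‖g k‖)
    (hw : inPN N w) {n : ℤ} (hn : -Nmin N ≤ n ∧ n ≤ Npl N) :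
    (w - interpI N (cmul (g - one1) (Cmn w))) n = fold N (rhOp g w) n := by
  have hws := hw.summable_norm
  have hg1 : cmul (g - one1) (Cmn w) = w - rhOp g w := by
    rw [rhOp_eq_sub_cmul hg (norm_le_tsum_norm hws), sub_sub_cancel]
  rw [Pi.sub_apply, interpI_of_mem hn, hg1, fold_sub hN hws (summable_norm_rhOp hg hws),
    Pi.sub_apply, fold_of_support hN (inPN_iff.1 hw), rep_of_mem hn, sub_sub_cancel]

theorem inPN_sub_interpI {N : ℕ} {w : ℤ → ℂ} (hw : inPN N w) (y : ℤ → ℂ) :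
    inPN N (w - interpI N y) :=
  inPN_iff.2 fun n hn => by
    rw [Pi.sub_apply, inPN_iff.1 hw n hn, interpI, if_neg hn, sub_zero]

theorem inPN_indicator {N : ℕ} {w : ℤ → ℂ} (hw : inPN N w) (S : Set ℤ) :
    inPN N (S.indicator w) :=
  inPN_iff.2 fun n hn => by
    rw [← norm_le_zero_iff, ← norm_zero (E := ℂ), ← inPN_iff.1 hw n hn]
    exact norm_indicator_le_norm_self _ _

theorem perSq_fold_of_inPN {N : ℕ} (hN : 0 < N) {w : ℤ → ℂ} (hw : inPN N w) :
    perSq N (-Nmin N) (fold N w) = perSq N (-Nmin N) w := by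
  refine Finset.sum_congr rfl fun n hn => ?_
  rw [Finset.mem_Ico] at hn
  have := neg_Nmin_add N
  rw [fold_of_support hN (inPN_iff.1 hw), rep_of_mem ⟨hn.1, by omega⟩]

theorem norm_sq_le_perSq {N : ℕ} (w : ℤ → ℂ) {n : ℤ} (hn : -Nmin N ≤ n ∧ n ≤ Npl N) :
    ‖w n‖ ^ 2 ≤ perSq N (-Nmin N) w := by
  have := neg_Nmin_add N
  exact Finset.single_le_sum (f := fun n => ‖w n‖ ^ 2) (fun _ _ => by positivity)
    (Finset.mem_Ico.2 ⟨hn.1, by omega⟩)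

/-- Stability of the collocation operators on `ran 𝒫_N`. -/
theorem exists_collocation_stability {g : ℤ → ℂ} (hg : Summable fun k => ‖g k‖) {c : ℝ}
    (hc : 0 < c) (h1 : ∀ v, ‖v‖ ≤ c * ‖L2Z.sio g (Set.Iio 0) v‖)
    (h2 : ∀ v, ‖v‖ ≤ c * ‖L2Z.sio g (Set.Ici 0) v‖) :
    ∃ N₀ : ℕ, ∀ N : ℕ, N₀ < N → ∀ w, inPN N w →
      √(perSq N (-Nmin N) w) ≤ 4 * c * √(perSq N (-Nmin N) (fold N (rhOp g w))) := by
  obtain ⟨N₀, h⟩ := exists_periodic_stability hg hc h1 h2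
  refine ⟨N₀, fun N hN w hw => ?_⟩
  have hN0 : 0 < N := by omega
  have hws := hw.summable_norm
  have hx := inPN_indicator hw (Set.Iio 0)
  rw [← perSq_fold_of_inPN hN0 hw]
  refine h N hN (fold N w) (fold N ((Set.Iio 0).indicator w)) _ (fold_add_period N _)
    (fold_add_period N _) (fold_add_period N _) (fun n hn hm => ?_)
    ⟨_, norm_fold_le hN0 (summable_norm_indicator hws _)⟩
    (fun n => by rw [fold_rhOp hN0 hg hws]; rfl) _
  rw [fold_of_support hN0 (inPN_iff.1 hx), rep_of_mem ⟨hn, hm⟩, Set.indicator_apply,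
    Set.indicator_apply, fold_of_support hN0 (inPN_iff.1 hw), rep_of_mem ⟨hn, hm⟩]

/-- Injectivity of the collocation operator on `ran 𝒫_N` gives unique solvability. -/
theorem existsUnique_collocation {N : ℕ} (hN : 0 < N) {g : ℤ → ℂ} (hg : Summable fun k => ‖g k‖)
    (hinj : ∀ w, inPN N w → (∀ n, -Nmin N ≤ n ∧ n ≤ Npl N → fold N (rhOp g w) n = 0) → w = 0)
    {f : ℤ → ℂ} (hf : inPN N f) :
    ∃! w : ℤ → ℂ, inPN N w ∧ w - interpI N (cmul (g - one1) (Cmn w)) = f := by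
  classical
  let I : Finset ℤ := Finset.Icc (-Nmin N) (Npl N)
  have hI : ∀ n, n ∈ I ↔ -Nmin N ≤ n ∧ n ≤ Npl N := fun n => Finset.mem_Icc
  let E : (I → ℂ) →ₗ[ℂ] (ℤ → ℂ) :=
    { toFun v n := if h : n ∈ I then v ⟨n, h⟩ else 0
      map_add' x y := by
        ext n
        by_cases h : n ∈ I <;> simp [h]
      map_smul' a x := by
        ext n
        by_cases h : n ∈ I <;> simp [h] }
  have hE : ∀ v, inPN N (E v) := fun v => inPN_iff.2 fun n hn => dif_neg (by rwa [hI])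
  have hEI : ∀ v (i : I), E v i = v i := fun v i => dif_pos i.2
  let T : (I → ℂ) →ₗ[ℂ] (I → ℂ) :=
    { toFun v i := fold N (rhOp g (E v)) i
      map_add' x y := by
        ext i
        have h : rhOp g (E (x + y)) = rhOp g (E x) + rhOp g (E y) := by
          have h := rhOp_sub hg (norm_le_tsum_norm (hE (x + y)).summable_norm)
            (norm_le_tsum_norm (hE y).summable_norm)
          rw [map_add, add_sub_cancel_right] at h
          rw [h, map_add, sub_add_cancel]
        rw [h, fold_add hN (summable_norm_rhOp hg (hE x).summable_norm)
          (summable_norm_rhOp hg (hE y).summable_norm)]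
        rfl
      map_smul' a x := by
        ext i
        have h : rhOp g (E (a • x)) = a • rhOp g (E x) := by
          have h : (Set.Iio 0).indicator (a • E x) = a • (Set.Iio 0).indicator (E x) :=
            Set.indicator_const_smul _ a (E x)
          rw [map_smul, rhOp_eq, rhOp_eq, h, cmul_smul, smul_add, smul_sub]
        rw [h]
        simp only [fold, Pi.smul_apply, smul_eq_mul, tsum_mul_left, RingHom.id_apply] }
  have hTinj : Function.Injective T := by
    refine (injective_iff_map_eq_zero T).2 fun v hv => ?_
    have := hinj (E v) (hE v) fun n hn => congrFun hv ⟨n, (hI n).2 hn⟩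
    ext i
    rw [← hEI v, this]
    rfl
  have key : ∀ w, inPN N w → (w - interpI N (cmul (g - one1) (Cmn w)) = f ↔
      ∀ n, -Nmin N ≤ n ∧ n ≤ Npl N → fold N (rhOp g w) n = f n) := fun w hw => by
    refine ⟨fun h n hn => ?_, fun h => funext fun n => ?_⟩
    · rw [← sub_interpI_apply hN hg hw hn, h]
    · by_cases hn : -Nmin N ≤ n ∧ n ≤ Npl N
      · rw [sub_interpI_apply hN hg hw hn, h n hn]
      · rw [inPN_iff.1 (inPN_sub_interpI hw _) n hn, inPN_iff.1 hf n hn]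
  obtain ⟨v, hv⟩ := LinearMap.injective_iff_surjective.1 hTinj fun i => f i
  have hEv : ∀ n, -Nmin N ≤ n ∧ n ≤ Npl N → fold N (rhOp g (E v)) n = f n := fun n hn =>
    congrFun hv ⟨n, (hI n).2 hn⟩
  refine ⟨E v, ⟨hE v, (key _ (hE v)).2 hEv⟩, fun w ⟨hw, hwf⟩ => sub_eq_zero.1 ?_⟩
  rw [key w hw] at hwf
  refine hinj _ (inPN_iff.2 fun n hn => ?_) fun n hn => ?_
  · rw [Pi.sub_apply, inPN_iff.1 hw n hn, inPN_iff.1 (hE v) n hn, sub_zero]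
  · rw [rhOp_sub hg (norm_le_tsum_norm hw.summable_norm) (norm_le_tsum_norm (hE v).summable_norm),
      fold_sub hN (summable_norm_rhOp hg hw.summable_norm)
        (summable_norm_rhOp hg (hE v).summable_norm), Pi.sub_apply, hwf n hn, hEv n hn, sub_self]

theorem norm_tsum_sq_le {ι : Type*} {f : ι → ℂ} {a b : ι → ℝ} (ha : ∀ n, 0 ≤ a n)
    (hb : ∀ n, 0 ≤ b n) (has : Summable fun n => a n ^ 2) (hbs : Summable fun n => b n ^ 2)
    (h : ∀ n, ‖f n‖ ≤ a n * b n) :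
    ‖∑' n, f n‖ ^ 2 ≤ (∑' n, a n ^ 2) * ∑' n, b n ^ 2 := by
  simp only [← Real.rpow_two] at has hbs
  have h1 := Real.summable_and_inner_le_Lp_mul_Lq_tsum_of_nonneg Real.HolderConjugate.two_two
    ha hb has hbs
  have h2 := (tsum_of_norm_bounded h1.1.hasSum h).trans h1.2
  simp only [Real.rpow_two, ← Real.sqrt_eq_rpow] at h2
  refine (pow_le_pow_left₀ (norm_nonneg _) h2 2).trans_eq ?_
  rw [mul_pow, Real.sq_sqrt (tsum_nonneg fun _ => by positivity),
    Real.sq_sqrt (tsum_nonneg fun _ => by positivity)]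

theorem perSq_cmul_le {g Y : ℤ → ℂ} (hg : Summable fun k => ‖g k‖) {N : ℕ}
    (hY : ∀ n, Y (n + N) = Y n) {B : ℝ} (hB : ∀ n, ‖Y n‖ ≤ B) (a : ℤ) :
    perSq N a (cmul g Y) ≤ (∑' k, ‖g k‖) ^ 2 * perSq N a Y := by
  have hsum : ∀ n, Summable fun k => ‖g k‖ * ‖Y (n - k)‖ ^ 2 := fun n =>
    Summable.of_nonneg_of_le (fun k => by positivity)
      (fun k => mul_le_mul_of_nonneg_left (pow_le_pow_left₀ (norm_nonneg _) (hB _) 2)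
        (norm_nonneg _)) (hg.mul_right (B ^ 2))
  have h1 : ∀ n, ‖cmul g Y n‖ ^ 2 ≤ (∑' k, ‖g k‖) * ∑' k, ‖g k‖ * ‖Y (n - k)‖ ^ 2 := fun n => by
    have e1 : ∀ k, √‖g k‖ ^ 2 = ‖g k‖ := fun k => Real.sq_sqrt (norm_nonneg _)
    have e2 : ∀ k, (√‖g k‖ * ‖Y (n - k)‖) ^ 2 = ‖g k‖ * ‖Y (n - k)‖ ^ 2 := fun k => by
      rw [mul_pow, e1]
    have h := norm_tsum_sq_le (f := fun k => g k * Y (n - k)) (a := fun k => √‖g k‖)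
      (b := fun k => √‖g k‖ * ‖Y (n - k)‖) (fun k => Real.sqrt_nonneg _)
      (fun k => by positivity) (by simpa only [e1] using hg) (by simpa only [e2] using hsum n)
      (fun k => by rw [← mul_assoc, ← sq, e1, norm_mul])
    simpa only [e1, e2, ← cmul_apply'] using h
  have h2 : ∀ k, ∑ n ∈ Finset.Ico a (a + N), ‖g k‖ * ‖Y (n - k)‖ ^ 2 = ‖g k‖ * perSq N a Y := by
    intro k
    rw [← Finset.mul_sum, perSq_eq hY a (a + -k), ← perSq_shift]
    simp only [perSq, sub_eq_add_neg]
  calc perSq N a (cmul g Y)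
      ≤ ∑ n ∈ Finset.Ico a (a + N), (∑' k, ‖g k‖) * ∑' k, ‖g k‖ * ‖Y (n - k)‖ ^ 2 :=
        Finset.sum_le_sum fun n _ => h1 n
    _ = (∑' k, ‖g k‖) ^ 2 * perSq N a Y := by
        rw [← Finset.mul_sum, ← Summable.tsum_finsetSum fun n _ => hsum n]
        simp only [h2, tsum_mul_right]
        ring

theorem perSq_add_le (N : ℕ) (a : ℤ) (V W : ℤ → ℂ) :
    perSq N a (V + W) ≤ 2 * (perSq N a V + perSq N a W) := by
  unfold perSq
  rw [← Finset.sum_add_distrib, Finset.mul_sum]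
  refine Finset.sum_le_sum fun n _ => ?_
  have := norm_add_le (V n) (W n)
  rw [Pi.add_apply]
  nlinarith [norm_nonneg (V n + W n), sq_nonneg (‖V n‖ - ‖W n‖)]

theorem half_le_abs_of_not_mem_window {N : ℕ} {n : ℤ} (hn : ¬(-Nmin N ≤ n ∧ n ≤ Npl N)) :
    (N : ℤ) ≤ 2 * |n| := by
  unfold Nmin Npl at hn
  rcases abs_cases n with h | h <;> omega

theorem wt_le_of_mem_window {N : ℕ} (hN : 0 < N) {n : ℤ} (hn : -Nmin N ≤ n ∧ n ≤ Npl N) :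
    wt n ≤ N := by
  refine max_le (by exact_mod_cast hN) ?_
  have : |n| ≤ N := by
    unfold Nmin Npl at hn
    rcases abs_cases n with h | h <;> omega
  exact_mod_cast this

theorem half_le_wt_of_not_mem_window {N : ℕ} {n : ℤ} (hn : ¬(-Nmin N ≤ n ∧ n ≤ Npl N)) :
    (N : ℝ) / 2 ≤ wt n := by
  have : ((N : ℤ) : ℝ) ≤ ((2 * |n| : ℤ) : ℝ) := by exact_mod_cast half_le_abs_of_not_mem_window hn
  push_cast at this
  exact le_max_of_le_right (by linarith)

theorem half_mul_wt_le_wt_mul_add {N : ℕ} {n p : ℤ} (hp : p ≠ 0)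
    (hn : -Nmin N ≤ n ∧ n ≤ Npl N) : (N : ℝ) / 2 * wt p ≤ wt (p * N + n) := by
  have h1 : 2 * |n| ≤ N := by
    unfold Nmin Npl at hn
    rcases abs_cases n with h | h <;> omega
  have h2 : (1 : ℝ) ≤ |(p : ℝ)| := by exact_mod_cast Int.one_le_abs hp
  have h3 : (2 : ℝ) * |(n : ℝ)| ≤ N := by exact_mod_cast h1
  have h4 : wt p = |(p : ℝ)| := max_eq_right h2
  rw [h4]
  refine le_max_of_le_right ?_
  push_cast
  have h5 : |(p : ℝ) * N| ≤ |(p : ℝ) * N + n| + |(n : ℝ)| := by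
    simpa using abs_sub (p * N + n : ℝ) n
  rw [abs_mul, Nat.abs_cast] at h5
  have h6 : (N : ℝ) ≤ |(p : ℝ)| * N := le_mul_of_one_le_left N.cast_nonneg h2
  linarith

/-- Aliasing estimate: the periodization of a sequence in `H^t` without low frequencies. -/
theorem perSq_fold_le {t : ℝ} (ht : 1 ≤ t) {N : ℕ} (hN : 0 < N) {u y : ℤ → ℂ} (hu : hsumm t u)
    (hyu : ∀ n, ‖y n‖ ≤ ‖u n‖) (hy : ∀ n, -Nmin N ≤ n ∧ n ≤ Npl N → y n = 0) :
    perSq N (-Nmin N) (fold N y) ≤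
      (∑' p, wt p ^ (-(2 * t))) * ((N : ℝ) / 2) ^ (-(2 * t)) *
        ∑' n, ‖u n‖ ^ 2 * wt n ^ (2 * t) := by
  have hN2 : (0 : ℝ) < (N : ℝ) / 2 := by positivity
  set b : ℤ → ℝ := fun n => ‖u n‖ ^ 2 * wt n ^ (2 * t) with hb
  have hb0 : ∀ n, 0 ≤ b n := fun n => mul_nonneg (by positivity) (Real.rpow_nonneg (wt_pos n).le _)
  have hbs : Summable b := hu
  set I := Finset.Ico (-Nmin N) (-Nmin N + N) with hI
  have hIw : ∀ n ∈ I, -Nmin N ≤ n ∧ n ≤ Npl N := fun n hn => by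
    rw [hI, Finset.mem_Ico, neg_Nmin_add] at hn
    exact ⟨hn.1, by omega⟩
  have sq_rpow : ∀ x : ℝ, 0 < x → ∀ e : ℝ, (x ^ e) ^ 2 = x ^ (2 * e) := fun x hx e => by
    rw [← Real.rpow_natCast, ← Real.rpow_mul hx.le]
    congr 1
    push_cast
    ring
  -- Cauchy–Schwarz on each residue class
  have h1 : ∀ n ∈ I, ‖fold N y n‖ ^ 2 ≤
      (∑' p, wt p ^ (-(2 * t))) * ((N : ℝ) / 2) ^ (-(2 * t)) * ∑' p : ℤ, b (p * N + n) := by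
    intro n hn
    have e1 : ∀ p, (((N : ℝ) / 2) ^ (-t) * wt p ^ (-t)) ^ 2 =
        ((N : ℝ) / 2) ^ (-(2 * t)) * wt p ^ (-(2 * t)) := fun p => by
      rw [mul_pow, sq_rpow _ hN2, sq_rpow _ (wt_pos p), mul_neg]
    have e2 : ∀ p : ℤ, (‖u (p * N + n)‖ * wt (p * N + n) ^ t) ^ 2 = b (p * N + n) := fun p => by
      rw [mul_pow, sq_rpow _ (wt_pos _)]
    have h := norm_tsum_sq_le (f := fun p : ℤ => y (p * N + n))
      (a := fun p => ((N : ℝ) / 2) ^ (-t) * wt p ^ (-t))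
      (b := fun p : ℤ => ‖u (p * N + n)‖ * wt (p * N + n) ^ t)
      (fun p => mul_nonneg (Real.rpow_nonneg hN2.le _) (Real.rpow_nonneg (wt_pos p).le _))
      (fun p => mul_nonneg (norm_nonneg _) (Real.rpow_nonneg (wt_pos _).le _))
      (by simpa only [e1] using (summable_wt_rpow_neg (b := 2 * t) (by linarith)).mul_left _)
      (by simpa only [e2] using! hbs.comp_injective (mul_add_injective hN n))
      (fun p => by
        have hpos : 0 < wt (p * N + n) ^ t := Real.rpow_pos_of_pos (wt_pos _) _
        by_cases hp : p = 0
        · have h0 : p * N + n = n := by rw [hp, zero_mul, zero_add]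
          rw [h0, hy n (hIw n hn), norm_zero]
          exact mul_nonneg (mul_nonneg (Real.rpow_nonneg hN2.le _)
            (Real.rpow_nonneg (wt_pos p).le _))
            (mul_nonneg (norm_nonneg _) (Real.rpow_nonneg (wt_pos _).le _))
        · have h3 : ((N : ℝ) / 2 * wt p) ^ t ≤ wt (p * N + n) ^ t :=
            Real.rpow_le_rpow (mul_nonneg hN2.le (wt_pos p).le)
              (half_mul_wt_le_wt_mul_add hp (hIw n hn)) (by linarith)
          have h4 : 0 < ((N : ℝ) / 2 * wt p) ^ t :=
            Real.rpow_pos_of_pos (mul_pos hN2 (wt_pos p)) _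
          rw [← Real.mul_rpow hN2.le (wt_pos p).le,
            Real.rpow_neg (mul_nonneg hN2.le (wt_pos p).le), mul_left_comm]
          refine (hyu _).trans (le_mul_of_one_le_right (norm_nonneg _) ?_)
          rwa [inv_mul_eq_div, one_le_div h4])
    simp only [e1, e2, tsum_mul_left] at h
    rw [mul_comm (∑' p, wt p ^ (-(2 * t)))]
    exact h
  have h2 : ∑ n ∈ I, ∑' p : ℤ, b (p * N + n) ≤ ∑' n, b n := by
    have hinj : Function.Injective fun q : I × ℤ => q.2 * (N : ℤ) + (q.1 : ℤ) := fun q q' h => by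
      have hm := fun x : I => rep_of_mem (hIw x x.2)
      have h' := congrArg (rep N) h
      simp only [rep_mul_add, hm] at h'
      simp only [h'] at h
      exact Prod.ext (Subtype.ext h') (mul_add_injective hN _ h)
    have hs := hbs.comp_injective hinj
    have h3 := tsum_comp_le_tsum_of_inj hbs hb0 hinj
    rw [hs.tsum_prod, tsum_fintype] at h3
    rw [← Finset.sum_coe_sort]
    exact h3
  have hZ : 0 ≤ ∑' p, wt p ^ (-(2 * t)) := tsum_nonneg fun p => Real.rpow_nonneg (wt_pos p).le _
  calc perSq N (-Nmin N) (fold N y)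
      ≤ ∑ n ∈ I, (∑' p, wt p ^ (-(2 * t))) * ((N : ℝ) / 2) ^ (-(2 * t)) *
          ∑' p : ℤ, b (p * N + n) := Finset.sum_le_sum h1
    _ ≤ _ := by
        rw [← Finset.mul_sum]
        exact mul_le_mul_of_nonneg_left h2 (mul_nonneg hZ (Real.rpow_nonneg hN2.le _))

/-- Consistency: the periodized operator applied to the high frequencies of `u`. -/
theorem perSq_fold_rhOp_le {t : ℝ} (ht : 1 ≤ t) {N : ℕ} (hN : 0 < N) {g u y : ℤ → ℂ}
    (hg : Summable fun k => ‖g k‖) (hu : hsumm t u)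
    (hyu : ∀ n, ‖y n‖ ≤ ‖u n‖) (hy : ∀ n, -Nmin N ≤ n ∧ n ≤ Npl N → y n = 0) :
    perSq N (-Nmin N) (fold N (rhOp g y)) ≤
      2 * (1 + (∑' k, ‖g k‖) ^ 2) * ((∑' p, wt p ^ (-(2 * t))) * ((N : ℝ) / 2) ^ (-(2 * t)) *
        ∑' n, ‖u n‖ ^ 2 * wt n ^ (2 * t)) := by
  have hys : Summable fun k => ‖y k‖ :=
    Summable.of_nonneg_of_le (fun _ => norm_nonneg _) hyu (hu.summable_norm ht)
  have hind : ∀ S : Set ℤ, perSq N (-Nmin N) (fold N (S.indicator y)) ≤ _ := fun S =>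
    perSq_fold_le ht hN hu (fun n => (norm_indicator_le_norm_self _ _).trans (hyu n))
      fun n hn => by
        rw [← norm_le_zero_iff, ← norm_zero (E := ℂ), ← hy n hn]
        exact norm_indicator_le_norm_self _ _
  have hx := summable_norm_indicator hys (Set.Iio 0)
  rw [rhOp_eq, ← Set.indicator_compl,
    fold_add hN (summable_norm_indicator hys _) (summable_norm_cmul hg hx), fold_cmul hN hg hx]
  refine (perSq_add_le _ _ _ _).trans ?_
  have h1 := hind (Set.Iio 0)ᶜ
  have h2 := perSq_cmul_le hg (fold_add_period N ((Set.Iio 0).indicator y)) (norm_fold_le hN hx)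
    (-Nmin N)
  have h3 := mul_le_mul_of_nonneg_left (hind (Set.Iio 0)) (sq_nonneg (∑' k, ‖g k‖))
  linarith

theorem inPN_projP (N : ℕ) (u : ℤ → ℂ) : inPN N (projP N u) :=
  inPN_iff.2 fun _ hn => if_neg hn

theorem inPN.sub {N : ℕ} {v w : ℤ → ℂ} (hv : inPN N v) (hw : inPN N w) : inPN N (v - w) :=
  inPN_iff.2 fun n hn => by
    rw [Pi.sub_apply, inPN_iff.1 hv n hn, inPN_iff.1 hw n hn, sub_zero]

theorem sub_projP_of_mem {N : ℕ} (u : ℤ → ℂ) {n : ℤ} (hn : -Nmin N ≤ n ∧ n ≤ Npl N) :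
    (u - projP N u) n = 0 := by
  rw [Pi.sub_apply, projP, if_pos hn, sub_self]

theorem sub_projP_of_notMem {N : ℕ} (u : ℤ → ℂ) {n : ℤ} (hn : ¬(-Nmin N ≤ n ∧ n ≤ Npl N)) :
    (u - projP N u) n = u n := by
  rw [Pi.sub_apply, projP, if_neg hn, sub_zero]

theorem perSq_congr {N : ℕ} {V W : ℤ → ℂ}
    (h : ∀ n, -Nmin N ≤ n ∧ n ≤ Npl N → ‖V n‖ = ‖W n‖) :
    perSq N (-Nmin N) V = perSq N (-Nmin N) W :=
  Finset.sum_congr rfl fun n hn => by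
    rw [Finset.mem_Ico, neg_Nmin_add] at hn
    rw [h n ⟨hn.1, by omega⟩]

/-- The `H^s` norm is controlled by the `L²` norm on the window and the `H^t` norm off it. -/
theorem hnorm_sub_le {s t : ℝ} (hs : 0 ≤ s) (hst : s ≤ t) {N : ℕ} (hN : 0 < N) {u w : ℤ → ℂ}
    (hu : hsumm t u) (hw : inPN N w) :
    hnorm s (u - w) ≤ √(N ^ (2 * s) * perSq N (-Nmin N) (u - w) +
      ((N : ℝ) / 2) ^ (2 * (s - t)) * ∑' n, ‖u n‖ ^ 2 * wt n ^ (2 * t)) := by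
  classical
  have hN2 : (0 : ℝ) < (N : ℝ) / 2 := by positivity
  have hsum := ((hasSum_ite_mem_finset (Finset.Ico (-Nmin N) (-Nmin N + N))
    fun n => ‖(u - w) n‖ ^ 2).mul_left ((N : ℝ) ^ (2 * s))).add
      (Summable.hasSum hu |>.mul_left (((N : ℝ) / 2) ^ (2 * (s - t))))
  refine Real.sqrt_le_sqrt ?_
  have hle : ∀ n, ‖(u - w) n‖ ^ 2 * wt n ^ (2 * s) ≤
      (N : ℝ) ^ (2 * s) *
        (if n ∈ Finset.Ico (-Nmin N) (-Nmin N + N) then ‖(u - w) n‖ ^ 2 else 0) +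
      ((N : ℝ) / 2) ^ (2 * (s - t)) * (‖u n‖ ^ 2 * wt n ^ (2 * t)) := fun n => by
    have hmem : n ∈ Finset.Ico (-Nmin N) (-Nmin N + N) ↔ -Nmin N ≤ n ∧ n ≤ Npl N := by
      rw [Finset.mem_Ico, neg_Nmin_add, Int.lt_add_one_iff]
    have hpos := Real.rpow_nonneg (wt_pos n).le (2 * t)
    have hpos' := Real.rpow_nonneg hN2.le (2 * (s - t))
    by_cases hn : -Nmin N ≤ n ∧ n ≤ Npl N
    · rw [if_pos (hmem.2 hn), mul_comm]
      refine le_add_of_le_of_nonneg ?_ (by positivity)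
      exact mul_le_mul_of_nonneg_right
        (Real.rpow_le_rpow (wt_pos n).le (wt_le_of_mem_window hN hn) (by linarith)) (by positivity)
    · rw [if_neg (mt hmem.1 hn), mul_zero, zero_add, Pi.sub_apply, inPN_iff.1 hw n hn, sub_zero,
        mul_left_comm]
      refine mul_le_mul_of_nonneg_left ?_ (by positivity)
      rw [show 2 * s = 2 * (s - t) + 2 * t by ring, Real.rpow_add (wt_pos n)]
      exact mul_le_mul_of_nonneg_right
        (Real.rpow_le_rpow_of_nonpos hN2 (half_le_wt_of_not_mem_window hn) (by linarith)) hpos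
  refine ((Summable.of_nonneg_of_le (fun n => ?_) hle hsum.summable).tsum_le_tsum hle
    hsum.summable).trans hsum.tsum_eq.le
  exact mul_nonneg (by positivity) (Real.rpow_nonneg (wt_pos n).le _)

/-- **Statement 19.** Convergence of the collocation method for the Riemann–Hilbert
problem on the circle: for `N` large, `id - 𝓘_N 𝓜(g-1) 𝒞⁻` is invertible on `ran 𝒫_N`
and the solution `u_N` of `(id - 𝓘_N 𝓜(g-1) 𝒞⁻)u_N = 𝓘_N(g - 1)` satisfies
`‖u - u_N‖_s ≤ C_{s,t} N^{s-t}`. -/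
theorem RHP_collocation_convergence
    (t : ℝ) (ht : 1 ≤ t)
    (g : ℤ → ℂ) (hg : hsumm t g) (hnv : nonvanishing g)
    (u : ℤ → ℂ) (hu0 : hsumm 0 u) (hut : hsumm t u)
    (hueq : Cpl u - cmul g (Cmn u) = g - one1)
    (huniq : ∀ u' : ℤ → ℂ, hsumm 0 u' → Cpl u' - cmul g (Cmn u') = g - one1 → u' = u)
    (s : ℝ) (hs : s = 0 ∨ 1 / 2 < s) (hst : 2 * s < t) :
    ∃ (N₀ : ℕ) (C : ℝ), 0 < C ∧ ∀ N : ℕ, N₀ < N →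
      (∀ f : ℤ → ℂ, inPN N f →
        ∃! w : ℤ → ℂ, inPN N w ∧
          w - interpI N (cmul (g - one1) (Cmn w)) = f) ∧
      ∀ uN : ℤ → ℂ, inPN N uN →
        uN - interpI N (cmul (g - one1) (Cmn uN)) = interpI N (g - one1) →
        hnorm s (u - uN) ≤ C * (N : ℝ) ^ (s - t) := by
  have hs0 : 0 ≤ s := by rcases hs with h | h <;> linarith
  have hgs := hg.summable_norm ht
  have hus := hut.summable_norm ht
  obtain ⟨c, hc, h1, h2⟩ := exists_norm_le_sio_Iio_Ici hgs hnv hus hu0 hueq huniq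
  obtain ⟨N₀, hstab⟩ := exists_collocation_stability hgs hc h1 h2
  set T := ∑' n, ‖u n‖ ^ 2 * wt n ^ (2 * t) with hT
  set D := (4 * c) ^ 2 * (2 * (1 + (∑' k, ‖g k‖) ^ 2) * ((∑' p, wt p ^ (-(2 * t))) * T)) with hD
  refine ⟨N₀, √(D * 2 ^ (2 * t) + 2 ^ (2 * (t - s)) * T) + 1, by positivity, fun N hN => ?_⟩
  have hN0 : 0 < N := by omega
  have hNr : (0 : ℝ) < N := by exact_mod_cast hN0
  refine ⟨fun f hf => existsUnique_collocation hN0 hgs (fun w hw hw0 => ?_) hf,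
    fun uN huN heq => ?_⟩
  · have h0 : perSq N (-Nmin N) (fold N (rhOp g w)) = 0 := by
      rw [perSq_congr (W := 0) fun n hn => by rw [hw0 n hn]; rfl]
      simp [perSq]
    have h3 := hstab N hN w hw
    rw [h0, Real.sqrt_zero, mul_zero, Real.sqrt_le_left le_rfl, zero_pow two_ne_zero] at h3
    funext n
    by_cases hn : -Nmin N ≤ n ∧ n ≤ Npl N
    · have := (norm_sq_le_perSq w hn).trans h3
      exact norm_le_zero_iff.1 (by nlinarith [norm_nonneg (w n)])
    · exact inPN_iff.1 hw n hn
  · set r := u - projP N u with hr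
    have hru : ∀ n, ‖r n‖ ≤ ‖u n‖ := fun n => by
      by_cases hn : -Nmin N ≤ n ∧ n ≤ Npl N
      · rw [hr, sub_projP_of_mem u hn, norm_zero]
        exact norm_nonneg _
      · rw [hr, sub_projP_of_notMem u hn]
    have hrs : Summable fun k => ‖r k‖ :=
      Summable.of_nonneg_of_le (fun _ => norm_nonneg _) hru hus
    have he : inPN N (projP N u - uN) := (inPN_projP N u).sub huN
    have hsplit : projP N u - uN = u - r - uN := by rw [hr, sub_sub_cancel]
    have herr : perSq N (-Nmin N) (fold N (rhOp g (projP N u - uN))) =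
        perSq N (-Nmin N) (fold N (rhOp g r)) := by
      refine perSq_congr fun n hn => ?_
      have hres : fold N (rhOp g uN) n = fold N (rhOp g u) n := by
        rw [← sub_interpI_apply hN0 hgs huN hn, heq, interpI_of_mem hn, rhOp, hueq]
      rw [hsplit, rhOp_sub hgs (norm_le_tsum_norm (summable_norm_sub hus hrs))
          (norm_le_tsum_norm huN.summable_norm),
        rhOp_sub hgs (norm_le_tsum_norm hus) (norm_le_tsum_norm hrs),
        fold_sub hN0 (summable_norm_sub (summable_norm_rhOp hgs hus) (summable_norm_rhOp hgs hrs))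
          (summable_norm_rhOp hgs huN.summable_norm),
        fold_sub hN0 (summable_norm_rhOp hgs hus) (summable_norm_rhOp hgs hrs), Pi.sub_apply,
        Pi.sub_apply, hres, sub_sub_cancel_left, norm_neg]
    have hcons := perSq_fold_rhOp_le ht hN0 hgs hut hru fun n hn => sub_projP_of_mem u hn
    have hst' := hstab N hN _ he
    rw [herr] at hst'
    have h3 := (Real.sqrt_le_left (by positivity)).1 hst'
    rw [mul_pow, Real.sq_sqrt (perSq_nonneg _ _ _)] at h3
    have h4 : perSq N (-Nmin N) (u - uN) ≤ D * ((N : ℝ) / 2) ^ (-(2 * t)) := by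
      rw [perSq_congr (W := projP N u - uN) fun n hn => by
        rw [Pi.sub_apply, Pi.sub_apply, projP, if_pos hn]]
      refine h3.trans ((mul_le_mul_of_nonneg_left hcons (by positivity)).trans_eq ?_)
      rw [hD]
      ring
    have h5 : (N : ℝ) ^ (2 * s) * (D * ((N : ℝ) / 2) ^ (-(2 * t))) +
        ((N : ℝ) / 2) ^ (2 * (s - t)) * T =
        (D * 2 ^ (2 * t) + 2 ^ (2 * (t - s)) * T) * ((N : ℝ) ^ (s - t)) ^ 2 := by
      have e1 : ((N : ℝ) ^ (s - t)) ^ 2 = (N : ℝ) ^ (2 * (s - t)) := by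
        rw [← Real.rpow_natCast, ← Real.rpow_mul hNr.le]
        congr 1
        push_cast
        ring
      have e2 : (N : ℝ) ^ (2 * (s - t)) = (N : ℝ) ^ (2 * s) * (N : ℝ) ^ (-(2 * t)) := by
        rw [← Real.rpow_add hNr]
        congr 1
        ring
      have e3 : ∀ a : ℝ, ((N : ℝ) / 2) ^ a = (N : ℝ) ^ a * 2 ^ (-a) := fun a => by
        rw [Real.div_rpow hNr.le zero_le_two, Real.rpow_neg zero_le_two, div_eq_mul_inv]
      rw [e1, e3, e3, neg_neg, show -(2 * (s - t)) = 2 * (t - s) by ring, e2]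
      ring
    refine (hnorm_sub_le hs0 (by linarith) hN0 hut huN).trans ?_
    calc _ ≤ √((D * 2 ^ (2 * t) + 2 ^ (2 * (t - s)) * T) * ((N : ℝ) ^ (s - t)) ^ 2) := by
          rw [← h5]
          gcongr
      _ = √(D * 2 ^ (2 * t) + 2 ^ (2 * (t - s)) * T) * (N : ℝ) ^ (s - t) := by
          rw [Real.sqrt_mul' _ (sq_nonneg _), Real.sqrt_sq (Real.rpow_nonneg hNr.le _)]
      _ ≤ _ := mul_le_mul_of_nonneg_right (by linarith) (Real.rpow_nonneg hNr.le _)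

end
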